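/- arXiv:1905.03038 — 2 statements merged into one kernel-verified Lean document; each statement's English description precedes it below -/
import Mathlib

section
/- Let C be a cycle of goods and n ≥ 2 agents with arbitrary nonnegative additive utility functions. Let c = max over integers d ≥ n of min( n/d , n/(⌈n²/d⌉ + n − 2) ). Then there exists an allocation of the goods into n connected bundles such that each agent i receives a bundle of value at least c·mms^(n)(C,u_i). -/
open scoped BigOperators

noncomputable section

/-- Total value of a bundle under an additive utility. -/
def bval {V : Type*} [DecidableEq V] (u : V → ℝ) (S : Finset V) : ℝ := ∑ v ∈ S, u v

/-- A `G`-bundle: a (possibly empty) set of vertices inducing a connected subgraph. -/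
def IsBundle {V : Type*} (G : SimpleGraph V) (S : Finset V) : Prop :=
  (S : Set V) = ∅ ∨ (G.induce (S : Set V)).Connected

/-- A split of the vertex set `A` into `n` pairwise disjoint `G`-bundles covering `A`. -/
def IsSplitOn {V : Type*} [DecidableEq V] (G : SimpleGraph V) (A : Finset V) (n : ℕ)
    (P : Fin n → Finset V) : Prop :=
  (∀ i, IsBundle G (P i)) ∧ (∀ i j, i ≠ j → Disjoint (P i) (P j)) ∧
  (∀ i, P i ⊆ A) ∧ (∀ v ∈ A, ∃ i, v ∈ P i)

/-- The maximin share over splits of `A` into `n` `G`-bundles. -/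
def mmsOn {V : Type*} [DecidableEq V] (G : SimpleGraph V) (A : Finset V)
    (n : ℕ) (u : V → ℝ) : ℝ :=
  sSup {q : ℝ | ∃ P : Fin n → Finset V, IsSplitOn G A n P ∧ ∀ i, q ≤ bval u (P i)}

/-- The maximin share `mms^(n)(G,u)`. -/
def mms {V : Type*} [DecidableEq V] [Fintype V] (G : SimpleGraph V)
    (n : ℕ) (u : V → ℝ) : ℝ := mmsOn G Finset.univ n u

/-- The cycle on `m` vertices, identified with `ZMod m`. -/
def cycleGraph (m : ℕ) : SimpleGraph (ZMod m) :=
  SimpleGraph.fromRel (fun v w => w = v + 1)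

end


/-- value of the integer interval `[a,b)`. -/
noncomputable def ival (U : ℕ → ℝ) (a b : ℕ) : ℝ := ∑ k ∈ Finset.Ico a b, U k

lemma ival_mono {U : ℕ → ℝ} (hU : ∀ k, 0 ≤ U k) {a b a' b' : ℕ} (h1 : a' ≤ a) (h2 : b ≤ b') :
    ival U a b ≤ ival U a' b' := by
  unfold ival
  apply Finset.sum_le_sum_of_subset_of_nonneg
  · exact Finset.Ico_subset_Ico h1 h2
  · intros; exact hU _

lemma ival_add {U : ℕ → ℝ} {a b d : ℕ} (h1 : a ≤ b) (h2 : b ≤ d) :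
    ival U a b + ival U b d = ival U a d := by
  unfold ival
  exact Finset.sum_Ico_consecutive _ h1 h2

lemma ival_self (U : ℕ → ℝ) (a : ℕ) : ival U a a = 0 := by simp [ival]

lemma ival_succ (U : ℕ → ℝ) {a b : ℕ} (h : a ≤ b) : ival U a (b+1) = ival U a b + U b := by
  unfold ival
  exact Finset.sum_Ico_succ_top h _

/-- `N` disjoint liked intervals inside `[p,q)`. -/
def Strong (n : ℕ) (U : ℕ → ℝ) (τ : ℝ) (N p q : ℕ) : Prop :=
  ∃ (I : Finset (Fin n)) (a b : Fin n → ℕ), N ≤ I.card ∧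
    (∀ i ∈ I, p ≤ a i ∧ b i ≤ q ∧ τ ≤ ival U (a i) (b i)) ∧
    (∀ i ∈ I, ∀ j ∈ I, i ≠ j → ∀ x, a i ≤ x → x < b i → a j ≤ x → x < b j → False)

lemma Strong.step {n : ℕ} {U : ℕ → ℝ} (hU : ∀ k, 0 ≤ U k) {τ : ℝ} {N p q p' : ℕ}
    (h : Strong n U τ (N+1) p q) (hmin : ∀ r, p ≤ r → r < p' → ival U p r < τ) (hp : p ≤ p') :
    Strong n U τ N p' q := by
  obtain ⟨I, a, b, hc, h1, h2⟩ := h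
  refine ⟨I.filter (fun i => p' ≤ a i), a, b, ?_, ?_, ?_⟩
  · have hb : (I.filter (fun i => ¬ p' ≤ a i)).card ≤ 1 := by
      rw [Finset.card_le_one]
      intro i hi j hj
      simp only [Finset.mem_filter, not_le] at hi hj
      by_contra hij
      have key : ∀ i ∈ I, a i < p' → p' ≤ b i := by
        intro i hi hlt
        by_contra hcon
        push Not at hcon
        obtain ⟨x1, x2, x3⟩ := h1 i hi
        rcases le_or_gt p (b i) with hpb | hpb
        · have := hmin (b i) hpb hcon
          have h5 : ival U (a i) (b i) ≤ ival U p (b i) := ival_mono hU x1 le_rfl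
          linarith
        · have := hmin p le_rfl (by omega)
          have h5 : ival U (a i) (b i) ≤ ival U p p := by
            have : ival U (a i) (b i) = 0 := by
              unfold ival
              rw [Finset.Ico_eq_empty (by omega)]; simp
            rw [this, ival_self]
          linarith
      have k1 := key i hi.1 hi.2
      have k2 := key j hj.1 hj.2
      exact h2 i hi.1 j hj.1 hij (p'-1) (by omega) (by omega) (by omega) (by omega)
    have := Finset.card_filter_add_card_filter_not (s := I) (fun i => p' ≤ a i)
    omega
  · intro i hi
    simp only [Finset.mem_filter] at hi
    exact ⟨hi.2, (h1 i hi.1).2⟩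
  · intro i hi j hj
    simp only [Finset.mem_filter] at hi hj
    exact h2 i hi.1 j hj.1

lemma path_lemma {n : ℕ} (U : Fin n → ℕ → ℝ) (hU : ∀ j k, 0 ≤ U j k) (τ : Fin n → ℝ)
    (hτ : ∀ j, 0 ≤ τ j) (q : ℕ) :
    ∀ (N : ℕ) (J Wk : Finset (Fin n)) (p : ℕ), J.card = N + 1 → Wk ⊆ J → p ≤ q →
    (∀ j ∈ J, j ∉ Wk → Strong n (U j) (τ j) (N+1) p q) →
    (∀ j ∈ Wk, τ j * ((N:ℝ) + Wk.card) ≤ ival (U j) p q) →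
    (∀ j ∈ Wk, ∀ k, U j k ≤ τ j) →
    ∃ α β : Fin n → ℕ, (∀ j ∈ J, p ≤ α j ∧ α j ≤ β j ∧ β j ≤ q ∧ τ j ≤ ival (U j) (α j) (β j)) ∧
      (∀ i ∈ J, ∀ j ∈ J, i ≠ j → ∀ x, α i ≤ x → x < β i → α j ≤ x → x < β j → False) ∧
      (∀ x, p ≤ x → x < q → ∃ j ∈ J, α j ≤ x ∧ x < β j) := by
  intro N
  have likes : ∀ (N : ℕ) (J Wk : Finset (Fin n)) (p : ℕ), Wk ⊆ J →
    (∀ j ∈ J, j ∉ Wk → Strong n (U j) (τ j) (N+1) p q) →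
    (∀ j ∈ Wk, τ j * ((N:ℝ) + Wk.card) ≤ ival (U j) p q) →
    ∀ j ∈ J, τ j ≤ ival (U j) p q := by
    intro N J Wk p hW hS hT j hj
    by_cases hw : j ∈ Wk
    · have := hT j hw
      have h1 : (1:ℝ) ≤ Wk.card := by
        exact_mod_cast Finset.card_pos.mpr ⟨j, hw⟩
      have h0 : (0:ℝ) ≤ N := Nat.cast_nonneg N
      nlinarith [hτ j]
    · obtain ⟨I, a, b, hc, h1, h2⟩ := hS j hj hw
      have : 0 < I.card := by omega
      obtain ⟨i, hi⟩ := Finset.card_pos.mp this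
      obtain ⟨x1, x2, x3⟩ := h1 i hi
      exact x3.trans (ival_mono (hU j) x1 x2)
  induction N with
  | zero =>
    intro J Wk p hJ hW hpq hS hT hg
    obtain ⟨j0, rfl⟩ := Finset.card_eq_one.mp hJ
    refine ⟨fun _ => p, fun _ => q, ?_, ?_, ?_⟩
    · intro j hj
      exact ⟨le_rfl, hpq, le_rfl, likes 0 _ Wk p hW hS hT j hj⟩
    · intro i hi j hj hij
      simp at hi hj
      exact absurd (hi.trans hj.symm) hij
    · intro x h1 h2
      exact ⟨j0, by simp, h1, h2⟩
  | succ N ih =>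
    intro J Wk p hJ hW hpq hS hT hg
    have hl := likes _ J Wk p hW hS hT
    have hex : ∃ r, p ≤ r ∧ ∃ j ∈ J, τ j ≤ ival (U j) p r := by
      have : 0 < J.card := by omega
      obtain ⟨j, hj⟩ := Finset.card_pos.mp this
      exact ⟨q, hpq, j, hj, hl j hj⟩
    classical
    obtain ⟨p', ⟨hpp', j0, hj0, hj0l⟩, hmin⟩ :
      ∃ p', (p ≤ p' ∧ ∃ j ∈ J, τ j ≤ ival (U j) p p') ∧
        ∀ r, p ≤ r → r < p' → ∀ j ∈ J, ival (U j) p r < τ j := by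
      refine ⟨Nat.find hex, Nat.find_spec hex, ?_⟩
      intro r hr hlt j hj
      have := Nat.find_min hex hlt
      push Not at this
      exact this hr j hj
    have hp'q : p' ≤ q := by
      by_contra hcon
      push Not at hcon
      have := hmin q hpq hcon j0 hj0
      have := hl j0 hj0
      linarith
    have hA : ∃ A ∈ J, τ A ≤ ival (U A) p p' ∧
        (A ∈ Wk ∨ ∀ j ∈ Wk, ival (U j) p p' < τ j) := by
      by_cases h : ∃ j ∈ Wk, τ j ≤ ival (U j) p p'
      · obtain ⟨j, hj, hjl⟩ := h
        exact ⟨j, hW hj, hjl, Or.inl hj⟩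
      · push Not at h
        exact ⟨j0, hj0, hj0l, Or.inr h⟩
    obtain ⟨A, hAJ, hAl, hAw⟩ := hA
    have hloss : ∀ j ∈ Wk, ival (U j) p p' ≤ 2 * τ j := by
      intro j hj
      rcases Nat.eq_or_lt_of_le hpp' with h | h
      · rw [← h, ival_self]; linarith [hτ j]
      · obtain ⟨r, rfl⟩ : ∃ r, p' = r + 1 := ⟨p' - 1, by omega⟩
        rw [ival_succ _ (by omega)]
        have := hmin r (by omega) (by omega) j (hW hj)
        have := hg j hj r
        linarith
    obtain ⟨α, β, h1, h2, h3⟩ := ih (J.erase A) (Wk.erase A) p'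
      (by rw [Finset.card_erase_of_mem hAJ]; omega) (Finset.erase_subset_erase _ hW) hp'q
      (by
        intro j hj hjw
        have hjA := Finset.ne_of_mem_erase hj
        have hjJ := Finset.mem_of_mem_erase hj
        have hjw' : j ∉ Wk := fun h => hjw (Finset.mem_erase.mpr ⟨hjA, h⟩)
        exact (hS j hjJ hjw').step (hU j) (fun r h1 h2 => hmin r h1 h2 j hjJ) hpp')
      (by
        intro j hj
        have hjA := Finset.ne_of_mem_erase hj
        have hjW := Finset.mem_of_mem_erase hj
        have hT' := hT j hjW
        rw [← ival_add hpp' hp'q] at hT'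
        push_cast at hT'
        rcases hAw with hAw | hAw
        · have hc := Finset.card_erase_add_one hAw
          have hc' : ((Wk.erase A).card : ℝ) + 1 = Wk.card := by exact_mod_cast hc
          have := hloss j hjW
          rw [← hc'] at hT'
          nlinarith
        · have hc : ((Wk.erase A).card : ℝ) ≤ Wk.card := by
            exact_mod_cast Finset.card_le_card (Finset.erase_subset _ _)
          have := hAw j hjW
          have := mul_le_mul_of_nonneg_left hc (hτ j)
          nlinarith)
      (fun j hj => hg j (Finset.mem_of_mem_erase hj))
    refine ⟨fun j => if j = A then p else α j, fun j => if j = A then p' else β j, ?_, ?_, ?_⟩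
    · intro j hj
      by_cases hjA : j = A
      · subst hjA
        simp only [if_true]
        exact ⟨le_rfl, hpp', hp'q, hAl⟩
      · simp only [if_neg hjA]
        obtain ⟨y1, y2⟩ := h1 j (Finset.mem_erase.mpr ⟨hjA, hj⟩)
        exact ⟨by omega, y2⟩
    · intro i hi j hj hij x
      by_cases hiA : i = A
      · have hjA : j ≠ A := fun h => hij (hiA.trans h.symm)
        have := (h1 j (Finset.mem_erase.mpr ⟨hjA, hj⟩)).1
        simp only [if_pos hiA, if_neg hjA]
        intros; omega
      · by_cases hjA : j = A
        · have := (h1 i (Finset.mem_erase.mpr ⟨hiA, hi⟩)).1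
          simp only [if_pos hjA, if_neg hiA]
          intros; omega
        · simp only [if_neg hiA, if_neg hjA]
          exact h2 i (Finset.mem_erase.mpr ⟨hiA, hi⟩) j (Finset.mem_erase.mpr ⟨hjA, hj⟩) hij x
    · intro x hx1 hx2
      by_cases hx : x < p'
      · exact ⟨A, hAJ, by simpa using ⟨hx1, hx⟩⟩
      · obtain ⟨j, hj, hjx⟩ := h3 x (by omega) hx2
        refine ⟨j, Finset.mem_of_mem_erase hj, ?_⟩
        simpa only [if_neg (Finset.ne_of_mem_erase hj)] using hjx

/-! ### arcs of the cycle -/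

/-- the arc `[a,b)` in the cycle. -/
def arc (m a b : ℕ) : Finset (ZMod m) := (Finset.Ico a b).image (fun k : ℕ => (k : ZMod m))

lemma mem_arc {m a b : ℕ} {v : ZMod m} : v ∈ arc m a b ↔ ∃ k : ℕ, a ≤ k ∧ k < b ∧ (k : ZMod m) = v := by
  simp [arc, and_assoc]

lemma cast_inj_window {m s x y : ℕ} (hx : s ≤ x) (hx' : x < s + m) (hy : s ≤ y) (hy' : y < s + m)
    (h : (x : ZMod m) = (y : ZMod m)) : x = y := by
  rw [ZMod.natCast_eq_natCast_iff] at h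
  have h1 : (x - s) + s ≡ (y - s) + s [MOD m] := by
    rw [Nat.sub_add_cancel hx, Nat.sub_add_cancel hy]; exact h
  have h2 := Nat.ModEq.add_right_cancel' s h1
  have h3 := Nat.ModEq.eq_of_lt_of_lt h2 (by omega) (by omega)
  omega

lemma exists_lift {m : ℕ} [NeZero m] (s : ℕ) (v : ZMod m) :
    ∃ k : ℕ, s ≤ k ∧ k < s + m ∧ (k : ZMod m) = v := by
  refine ⟨s + (v - (s : ZMod m)).val, by omega, ?_, ?_⟩
  · have := ZMod.val_lt (v - (s : ZMod m)); omega
  · push_cast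
    rw [ZMod.natCast_zmod_val]; ring

lemma bval_arc {m : ℕ} (u : ZMod m → ℝ) {a b : ℕ} (h : b ≤ a + m) :
    bval u (arc m a b) = ival (fun k => u (k : ZMod m)) a b := by
  unfold bval arc ival
  rw [Finset.sum_image]
  intro x hx y hy hxy
  simp only [Finset.coe_Ico, Set.mem_Ico] at hx hy
  exact cast_inj_window hx.1 (by omega) hy.1 (by omega) hxy

lemma adj_succ {m : ℕ} (hm : 3 ≤ m) (v : ZMod m) : (cycleGraph m).Adj v (v+1) := by
  unfold cycleGraph
  rw [SimpleGraph.fromRel_adj]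
  refine ⟨?_, Or.inl rfl⟩
  intro h
  have h1 : (1 : ZMod m) = 0 := by
    have := h.symm
    simpa using this
  have : Fact (1 < m) := ⟨by omega⟩
  exact one_ne_zero h1

lemma arc_bundle {m : ℕ} (hm : 3 ≤ m) (a b : ℕ) : IsBundle (cycleGraph m) (arc m a b) := by
  by_cases hab : a < b
  · right
    have ha : ∀ k, a ≤ k → k < b → (k : ZMod m) ∈ ((arc m a b : Finset (ZMod m)) : Set (ZMod m)) := by
      intro k h1 h2
      exact Finset.mem_coe.mpr (mem_arc.mpr ⟨k, h1, h2, rfl⟩)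
    have key : ∀ i (h : a + i < b), ((cycleGraph m).induce ((arc m a b : Finset (ZMod m)) : Set (ZMod m))).Reachable
        ⟨(a : ZMod m), ha a le_rfl hab⟩ ⟨((a + i : ℕ) : ZMod m), ha (a+i) (by omega) h⟩ := by
      intro i
      induction i with
      | zero => intro h; exact SimpleGraph.Reachable.refl _
      | succ i ih =>
        intro h
        refine (ih (by omega)).trans (SimpleGraph.Adj.reachable ?_)
        rw [SimpleGraph.comap_adj]
        have := adj_succ hm ((a + i : ℕ) : ZMod m)
        simpa [add_assoc] using this
    rw [SimpleGraph.connected_iff_exists_forall_reachable]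
    refine ⟨⟨(a : ZMod m), ha a le_rfl hab⟩, ?_⟩
    rintro ⟨v, hv⟩
    obtain ⟨k, h1, h2, rfl⟩ := mem_arc.mp (Finset.mem_coe.mp hv)
    obtain ⟨i, rfl⟩ := Nat.exists_eq_add_of_le h1
    exact key i h2
  · left
    simp [arc, Finset.Ico_eq_empty hab]

lemma bundle_arc {m : ℕ} [NeZero m] {S : Finset (ZMod m)} (hS : IsBundle (cycleGraph m) S)
    {s : ℕ} (hs : (s : ZMod m) ∉ S) :
    ∃ a b : ℕ, s + 1 ≤ a ∧ a ≤ b ∧ b ≤ s + m ∧ S = arc m a b := by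
  have hmpos : 0 < m := Nat.pos_of_ne_zero (NeZero.ne m)
  rcases Finset.eq_empty_or_nonempty S with rfl | hne
  · exact ⟨s+1, s+1, le_rfl, le_rfl, by omega, by simp [arc]⟩
  have hconn : ((cycleGraph m).induce (S : Set (ZMod m))).Connected := by
    rcases hS with h | h
    · exact absurd (Finset.coe_eq_empty.mp h) hne.ne_empty
    · exact h
  have hsm : ((s + m : ℕ) : ZMod m) ∉ S := by simpa using hs
  have hex : ∃ x, s + 1 ≤ x ∧ ((x : ℕ) : ZMod m) ∈ S := by
    obtain ⟨v, hv⟩ := hne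
    obtain ⟨k, h1, h2, rfl⟩ := exists_lift s v
    refine ⟨k, ?_, hv⟩
    rcases Nat.eq_or_lt_of_le h1 with h | h
    · subst h; exact absurd hv hs
    · exact h
  classical
  obtain ⟨x, ⟨hx1, hxS⟩, hxmin⟩ : ∃ x, (s + 1 ≤ x ∧ ((x : ℕ) : ZMod m) ∈ S) ∧
      ∀ y, s + 1 ≤ y → y < x → ((y : ℕ) : ZMod m) ∉ S :=
    ⟨Nat.find hex, Nat.find_spec hex, fun y h1 h2 h3 => Nat.find_min hex h2 ⟨h1, h3⟩⟩
  have hxlt : x < s + m := by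
    obtain ⟨v, hv⟩ := hne
    obtain ⟨k, h1, h2, rfl⟩ := exists_lift s v
    by_contra hcon
    refine hxmin k ?_ (by omega) hv
    rcases Nat.eq_or_lt_of_le h1 with h | h
    · subst h; exact absurd hv hs
    · exact h
  have hex2 : ∃ y, x ≤ y ∧ ((y : ℕ) : ZMod m) ∉ S := ⟨s + m, hxlt.le, hsm⟩
  obtain ⟨y, ⟨hy1, hyS⟩, hymin⟩ : ∃ y, (x ≤ y ∧ ((y : ℕ) : ZMod m) ∉ S) ∧
      ∀ z, x ≤ z → z < y → ((z : ℕ) : ZMod m) ∈ S :=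
    ⟨Nat.find hex2, Nat.find_spec hex2, fun z h1 h2 => by
      by_contra h3; exact Nat.find_min hex2 h2 ⟨h1, h3⟩⟩
  have hyle : y ≤ s + m := by
    by_contra hcon
    exact hsm (hymin (s+m) hxlt.le (by omega))
  have hpred : ((x : ℕ) : ZMod m) - 1 ∉ S := by
    obtain ⟨r, rfl⟩ : ∃ r, x = r + 1 := ⟨x - 1, by omega⟩
    have : (((r + 1 : ℕ) : ℕ) : ZMod m) - 1 = (r : ZMod m) := by push_cast; ring
    rw [this]
    rcases Nat.eq_or_lt_of_le hx1 with h | h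
    · have : s = r := by omega
      rw [← this]; exact hs
    · exact hxmin r (by omega) (by omega)
  refine ⟨x, y, hx1, hy1, hyle, ?_⟩
  apply Finset.Subset.antisymm
  · have step : ∀ v w : ZMod m, v ∈ arc m x y → w ∈ S → (cycleGraph m).Adj v w → w ∈ arc m x y := by
      intro v w hv hw hadj
      obtain ⟨k, h1, h2, rfl⟩ := mem_arc.mp hv
      unfold cycleGraph at hadj
      rw [SimpleGraph.fromRel_adj] at hadj
      rcases hadj.2 with h | h
      · have hw' : w = ((k+1 : ℕ) : ZMod m) := by push_cast; exact h
        rcases Nat.lt_or_ge (k+1) y with h3 | h3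
        · exact mem_arc.mpr ⟨k+1, by omega, h3, hw'.symm⟩
        · have : k + 1 = y := by omega
          rw [hw', this] at hw
          exact absurd hw hyS
      · have hw' : w = (k : ZMod m) - 1 := by rw [h]; ring
        rcases Nat.eq_or_lt_of_le h1 with h3 | h3
        · rw [hw', ← h3] at hw
          exact absurd hw hpred
        · refine mem_arc.mpr ⟨k-1, by omega, by omega, ?_⟩
          rw [hw', Nat.cast_sub (by omega)]; simp
    have walk : ∀ (v w : (S : Set (ZMod m))), ((cycleGraph m).induce (S : Set (ZMod m))).Walk v w →
        (v : ZMod m) ∈ arc m x y → (w : ZMod m) ∈ arc m x y := by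
      intro v w p
      induction p with
      | nil => exact id
      | cons h p ih =>
        intro hv
        rename_i a b d
        apply ih
        exact step a b hv (Finset.mem_coe.mp b.2) (by simpa using h)
    have hxy : x < y := by
      rcases Nat.eq_or_lt_of_le hy1 with h | h
      · rw [← h] at hyS; exact absurd hxS hyS
      · exact h
    intro w hw
    obtain ⟨p⟩ := hconn.preconnected ⟨(x : ZMod m), Finset.mem_coe.mpr hxS⟩ ⟨w, Finset.mem_coe.mpr hw⟩
    exact walk _ _ p (mem_arc.mpr ⟨x, le_rfl, hxy, rfl⟩)
  · intro v hv
    obtain ⟨k, h1, h2, rfl⟩ := mem_arc.mp hv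
    exact hymin k h1 h2

lemma strong_of_window {m n : ℕ} [NeZero m] {u : ZMod m → ℝ} {τ : ℝ} {P : Fin n → Finset (ZMod m)}
    (hP : IsSplitOn (cycleGraph m) Finset.univ n P) (hτ : ∀ i, τ ≤ bval u (P i)) {s t : ℕ}
    (hst : s < t) (htm : t ≤ s + m) (i0 : Fin n)
    (hmono : ∀ k, s ≤ k → k < t → (k : ZMod m) ∈ P i0) {N : ℕ} (hN : n = N + 1) :
    Strong n (fun k => u (k : ZMod m)) τ N t (s + m) := by
  obtain ⟨hB, hD, -, -⟩ := hP
  have key : ∀ i, ∃ a b : ℕ, i ≠ i0 → t ≤ a ∧ b ≤ s + m ∧ P i = arc m a b := by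
    intro i
    by_cases hi : i = i0
    · exact ⟨0, 0, fun h => absurd hi h⟩
    have hnot : ∀ k, s ≤ k → k < t → (k : ZMod m) ∉ P i := by
      intro k h1 h2 h3
      exact Finset.disjoint_left.mp (hD i i0 hi) h3 (hmono k h1 h2)
    obtain ⟨a, b, h1, h2, h3, h4⟩ := bundle_arc (hB i) (hnot s le_rfl hst)
    rcases Nat.eq_or_lt_of_le h2 with h | h
    · refine ⟨t, t, fun _ => ⟨le_rfl, htm, ?_⟩⟩
      rw [h4, h]; simp [arc]
    · refine ⟨a, b, fun _ => ⟨?_, h3, h4⟩⟩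
      by_contra hcon
      refine hnot a (by omega) (by omega) ?_
      rw [h4]
      exact mem_arc.mpr ⟨a, le_rfl, h, rfl⟩
  choose a b hab using key
  refine ⟨Finset.univ.erase i0, a, b, ?_, ?_, ?_⟩
  · rw [Finset.card_erase_of_mem (Finset.mem_univ _), Finset.card_fin]; omega
  · intro i hi
    obtain ⟨h1, h2, h3⟩ := hab i (Finset.ne_of_mem_erase hi)
    refine ⟨h1, h2, ?_⟩
    rw [← bval_arc u (by omega), ← h3]
    exact hτ i
  · intro i hi j hj hij x h1 h2 h3 h4
    obtain ⟨-, -, e1⟩ := hab i (Finset.ne_of_mem_erase hi)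
    obtain ⟨-, -, e2⟩ := hab j (Finset.ne_of_mem_erase hj)
    have f1 : (x : ZMod m) ∈ P i := by rw [e1]; exact mem_arc.mpr ⟨x, h1, h2, rfl⟩
    have f2 : (x : ZMod m) ∈ P j := by rw [e2]; exact mem_arc.mpr ⟨x, h3, h4, rfl⟩
    exact Finset.disjoint_left.mp (hD i j hij) f1 f2

lemma finish {m n N : ℕ} [NeZero m] (hm : 3 ≤ m) (hN : n = N + 2) (us : Fin n → ZMod m → ℝ)
    (hus : ∀ i v, 0 ≤ us i v) (τ : Fin n → ℝ) (hτ : ∀ j, 0 ≤ τ j) {s t : ℕ} (hst : s ≤ t)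
    (htm : t ≤ s + m) (A : Fin n) (hA : τ A ≤ ival (fun k => us A (k : ZMod m)) s t)
    (Wk : Finset (Fin n)) (hAW : A ∉ Wk)
    (hS : ∀ j, j ≠ A → j ∉ Wk → Strong n (fun k => us j (k : ZMod m)) (τ j) (N+1) t (s+m))
    (hT : ∀ j ∈ Wk, τ j * ((N:ℝ) + Wk.card) ≤ ival (fun k => us j (k : ZMod m)) t (s+m))
    (hg : ∀ j ∈ Wk, ∀ v, us j v ≤ τ j) :
    ∃ P : Fin n → Finset (ZMod m), IsSplitOn (cycleGraph m) Finset.univ n P ∧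
      ∀ i, τ i ≤ bval (us i) (P i) := by
  obtain ⟨α, β, h1, h2, h3⟩ := path_lemma (fun j k => us j (k : ZMod m)) (fun j k => hus j _) τ hτ (s+m)
    N (Finset.univ.erase A) Wk t
    (by rw [Finset.card_erase_of_mem (Finset.mem_univ _), Finset.card_fin]; omega)
    (fun j hj => Finset.mem_erase.mpr ⟨fun h => hAW (h ▸ hj), Finset.mem_univ _⟩) htm
    (fun j hj hw => hS j (Finset.ne_of_mem_erase hj) hw) hT (fun j hj k => hg j hj _)
  have hmem : ∀ j, j ≠ A → j ∈ Finset.univ.erase A :=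
    fun j hj => Finset.mem_erase.mpr ⟨hj, Finset.mem_univ _⟩
  obtain ⟨α', hα'⟩ : ∃ α' : Fin n → ℕ, α' = fun j => if j = A then s else α j := ⟨_, rfl⟩
  obtain ⟨β', hβ'⟩ : ∃ β' : Fin n → ℕ, β' = fun j => if j = A then t else β j := ⟨_, rfl⟩
  have hαA : α' A = s := by simp [hα']
  have hβA : β' A = t := by simp [hβ']
  have hα : ∀ j, j ≠ A → α' j = α j := fun j hj => by simp [hα', hj]
  have hβ : ∀ j, j ≠ A → β' j = β j := fun j hj => by simp [hβ', hj]
  have b1 : ∀ j, s ≤ α' j ∧ β' j ≤ s + m ∧ τ j ≤ ival (fun k => us j (k : ZMod m)) (α' j) (β' j) := by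
    intro j
    by_cases hj : j = A
    · subst hj; rw [hαA, hβA]; exact ⟨le_rfl, htm, hA⟩
    · rw [hα j hj, hβ j hj]
      obtain ⟨x1, x2, x3, x4⟩ := h1 j (hmem j hj)
      exact ⟨by omega, x3, x4⟩
  have b2 : ∀ i j, i ≠ j → ∀ x, α' i ≤ x → x < β' i → α' j ≤ x → x < β' j → False := by
    intro i j hij x
    by_cases hi : i = A
    · have hj : j ≠ A := fun h => hij (hi.trans h.symm)
      rw [hi, hαA, hβA, hα j hj, hβ j hj]
      have := (h1 j (hmem j hj)).1
      intros; omega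
    · by_cases hj : j = A
      · rw [hj, hαA, hβA, hα i hi, hβ i hi]
        have := (h1 i (hmem i hi)).1
        intros; omega
      · rw [hα i hi, hβ i hi, hα j hj, hβ j hj]
        exact h2 i (hmem i hi) j (hmem j hj) hij x
  refine ⟨fun j => arc m (α' j) (β' j), ⟨?_, ?_, ?_, ?_⟩, ?_⟩
  · intro i; exact arc_bundle hm _ _
  · intro i j hij
    rw [Finset.disjoint_left]
    intro v hv hv'
    obtain ⟨k, k1, k2, rfl⟩ := mem_arc.mp hv
    obtain ⟨l, l1, l2, hl⟩ := mem_arc.mp hv'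
    obtain ⟨x1, x2, -⟩ := b1 i
    obtain ⟨y1, y2, -⟩ := b1 j
    have : l = k := cast_inj_window (s := s) (by omega) (by omega) (by omega) (by omega) hl
    subst this
    exact b2 i j hij l k1 k2 l1 l2
  · intro i; exact Finset.subset_univ _
  · intro v _
    obtain ⟨k, k1, k2, rfl⟩ := exists_lift s v
    by_cases hk : k < t
    · exact ⟨A, mem_arc.mpr ⟨k, by rw [hαA]; exact k1, by rw [hβA]; exact hk, rfl⟩⟩
    · obtain ⟨j, hj, x1, x2⟩ := h3 k (by omega) k2
      have hjA := Finset.ne_of_mem_erase hj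
      exact ⟨j, mem_arc.mpr ⟨k, by rw [hα j hjA]; exact x1, by rw [hβ j hjA]; exact x2, rfl⟩⟩
  · intro i
    obtain ⟨x1, x2, x3⟩ := b1 i
    show τ i ≤ bval (us i) (arc m (α' i) (β' i))
    rw [bval_arc _ (by omega)]
    exact x3

lemma mms_attained {m n : ℕ} [NeZero m] (hm : 3 ≤ m) (hn : 2 ≤ n) (u : ZMod m → ℝ)
    (hu : ∀ v, 0 ≤ u v) :
    0 ≤ mms (cycleGraph m) n u ∧ ∃ P : Fin n → Finset (ZMod m),
      IsSplitOn (cycleGraph m) Finset.univ n P ∧ ∀ i, mms (cycleGraph m) n u ≤ bval u (P i) := by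
  have : NeZero n := ⟨by omega⟩
  have hb : ∀ S : Finset (ZMod m), 0 ≤ bval u S := fun S => Finset.sum_nonneg (fun v _ => hu v)
  have hex : ∃ P0 : Fin n → Finset (ZMod m), IsSplitOn (cycleGraph m) Finset.univ n P0 := by
    refine ⟨fun i => if i = 0 then arc m 0 m else ∅, ?_, ?_, ?_, ?_⟩
    · intro i
      dsimp only
      split_ifs
      · exact arc_bundle hm _ _
      · left; simp
    · intro i j hij
      dsimp only
      by_cases hi : i = 0
      · have : j ≠ 0 := fun h => hij (hi.trans h.symm)
        simp [this]
      · simp [hi]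
    · intro i; exact Finset.subset_univ _
    · intro v _
      refine ⟨0, ?_⟩
      simp only [if_true]
      obtain ⟨k, k1, k2, hk⟩ := exists_lift 0 v
      exact mem_arc.mpr ⟨k, k1, by omega, hk⟩
  classical
  let F : (Fin n → Finset (ZMod m)) → ℝ := fun P => Finset.univ.inf' Finset.univ_nonempty (fun i => bval u (P i))
  have hF : ∀ P q, q ≤ F P ↔ ∀ i, q ≤ bval u (P i) := by
    intro P q; simp [F, Finset.le_inf'_iff]
  obtain ⟨P0, hP0⟩ := hex
  obtain ⟨P, hP, hmax⟩ := Finset.exists_max_image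
    (Finset.univ.filter (fun P => IsSplitOn (cycleGraph m) Finset.univ n P)) F ⟨P0, by simp [hP0]⟩
  simp only [Finset.mem_filter, Finset.mem_univ, true_and] at hP hmax
  have hg : IsGreatest {q : ℝ | ∃ P : Fin n → Finset (ZMod m), IsSplitOn (cycleGraph m) Finset.univ n P ∧
      ∀ i, q ≤ bval u (P i)} (F P) := by
    constructor
    · exact ⟨P, hP, (hF P _).mp le_rfl⟩
    · rintro q ⟨Q, hQ, hq⟩
      exact ((hF Q q).mpr hq).trans (hmax Q hQ)
  have he : mms (cycleGraph m) n u = F P := hg.csSup_eq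
  rw [he]
  exact ⟨(hF P 0).mpr (fun i => hb _), P, hP, (hF P _).mp le_rfl⟩

lemma total_ge {m n : ℕ} [NeZero m] {u : ZMod m → ℝ} {μ : ℝ} {P : Fin n → Finset (ZMod m)}
    (hP : IsSplitOn (cycleGraph m) Finset.univ n P) (hμ : ∀ i, μ ≤ bval u (P i)) (s : ℕ) :
    (n : ℝ) * μ ≤ ival (fun k => u (k : ZMod m)) s (s + m) := by
  have harc : arc m s (s+m) = Finset.univ := by
    ext v; simp only [Finset.mem_univ, iff_true]
    exact mem_arc.mpr (exists_lift s v)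
  rw [← bval_arc u le_rfl, harc]
  obtain ⟨hB, hD, -, hC⟩ := hP
  have : (Finset.univ : Finset (ZMod m)) = Finset.univ.biUnion P := by
    ext v; simpa using hC v (Finset.mem_univ v)
  rw [this]
  unfold bval
  rw [Finset.sum_biUnion (fun i _ j _ hij => hD i j hij)]
  have := Finset.card_nsmul_le_sum (Finset.univ : Finset (Fin n)) (fun i => ∑ v ∈ P i, u v) μ
    (fun i _ => hμ i)
  simpa using this

/-- position `v` is a cut of the split `P`. -/
def IsCut {m n : ℕ} (P : Fin n → Finset (ZMod m)) (v : ℕ) : Prop :=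
  ∀ i, ¬ (((v : ZMod m) - 1) ∈ P i ∧ (v : ZMod m) ∈ P i)

lemma no_cut_mono {m n : ℕ} [NeZero m] {P : Fin n → Finset (ZMod m)}
    (hP : IsSplitOn (cycleGraph m) Finset.univ n P) {s t : ℕ}
    (h : ∀ v, s < v → v < t → ¬ IsCut P v) :
    ∃ i0, ∀ k, s ≤ k → k < t → (k : ZMod m) ∈ P i0 := by
  obtain ⟨hB, hD, -, hC⟩ := hP
  obtain ⟨i0, hi0⟩ := hC (s : ZMod m) (Finset.mem_univ _)
  refine ⟨i0, ?_⟩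
  intro k hk
  induction k, hk using Nat.le_induction with
  | base => intro _; exact hi0
  | succ k hk ih =>
    intro hkt
    have h1 := ih (by omega)
    have h2 := h (k+1) (by omega) hkt
    unfold IsCut at h2
    push Not at h2
    obtain ⟨i, hi1, hi2⟩ := h2
    have e : (((k+1 : ℕ) : ZMod m) - 1) = (k : ZMod m) := by push_cast; ring
    rw [e] at hi1
    by_cases hii : i = i0
    · rw [← hii]; exact hi2
    · exact absurd h1 (Finset.disjoint_left.mp (hD i i0 hii) hi1)

lemma exists_cut {m n : ℕ} [NeZero m] (hn : 2 ≤ n) {P : Fin n → Finset (ZMod m)}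
    (hP : IsSplitOn (cycleGraph m) Finset.univ n P) (hne : ∀ i, (P i).Nonempty) :
    ∃ v, 1 ≤ v ∧ IsCut P v := by
  by_contra hcon
  push Not at hcon
  obtain ⟨i0, hi0⟩ := no_cut_mono hP (s := 0) (t := m) (fun v h1 _ => hcon v h1)
  have hall : ∀ v : ZMod m, v ∈ P i0 := by
    intro v
    obtain ⟨k, h1, h2, rfl⟩ := exists_lift 0 v
    exact hi0 k h1 (by omega)
  have hall2 : ∃ i1 : Fin n, i1 ≠ i0 := by
    have : Nontrivial (Fin n) := Fin.nontrivial_iff_two_le.mpr hn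
    exact exists_ne i0
  obtain ⟨i1, hi1⟩ := hall2
  obtain ⟨v, hv⟩ := hne i1
  exact Finset.disjoint_left.mp (hP.2.1 i1 i0 hi1) hv (hall v)

open Classical in
lemma card_cuts {m n : ℕ} [NeZero m] {P : Fin n → Finset (ZMod m)}
    (hP : IsSplitOn (cycleGraph m) Finset.univ n P) {b : ℕ} (hb : 1 ≤ b) :
    ((Finset.Ico b (b+m)).filter (fun v => IsCut P v)).card ≤ n := by
  obtain ⟨hB, hD, -, hC⟩ := hP
  choose col hcol using fun v => hC v (Finset.mem_univ v)
  have key : ∀ v v' : ℕ, b ≤ v → v < v' → v' < b + m → IsCut P v → IsCut P v' →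
      col (v : ZMod m) ≠ col (v' : ZMod m) := by
    intro v v' h1 h2 h3 hv hv' heq
    obtain ⟨w, rfl⟩ : ∃ w, v = w + 1 := ⟨v - 1, by omega⟩
    obtain ⟨w', rfl⟩ : ∃ w', v' = w' + 1 := ⟨v' - 1, by omega⟩
    set i := col ((w + 1 : ℕ) : ZMod m) with hi
    have m1 : ((w + 1 : ℕ) : ZMod m) ∈ P i := hcol _
    have m2 : ((w' + 1 : ℕ) : ZMod m) ∈ P i := by rw [heq]; exact hcol _
    have e : (((w+1 : ℕ) : ZMod m) - 1) = (w : ZMod m) := by push_cast; ring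
    have e' : (((w'+1 : ℕ) : ZMod m) - 1) = (w' : ZMod m) := by push_cast; ring
    have n1 : (w : ZMod m) ∉ P i := fun h => hv i ⟨by rw [e]; exact h, m1⟩
    have n2 : (w' : ZMod m) ∉ P i := fun h => hv' i ⟨by rw [e']; exact h, m2⟩
    obtain ⟨x, y, x1, x2, x3, x4⟩ := bundle_arc (hB i) n1
    rw [x4] at m1 m2
    obtain ⟨k, k1, k2, hk⟩ := mem_arc.mp m1
    obtain ⟨l, l1, l2, hl⟩ := mem_arc.mp m2
    have hk' : k = w + 1 := cast_inj_window (s := w + 1) (by omega) (by omega) (by omega) (by omega) hk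
    have hl' : l = w' + 1 := cast_inj_window (s := w + 1) (by omega) (by omega) (by omega) (by omega) hl
    apply n2
    rw [x4]
    exact mem_arc.mpr ⟨w', by omega, by omega, rfl⟩
  have : ((Finset.Ico b (b+m)).filter (fun v => IsCut P v)).card ≤ (Finset.univ : Finset (Fin n)).card := by
    apply Finset.card_le_card_of_injOn (fun v : ℕ => col (v : ZMod m)) (fun _ _ => Finset.mem_coe.mpr (Finset.mem_univ _))
    intro v hv v' hv' heq
    simp only [Finset.coe_filter, Finset.mem_Ico, Set.mem_setOf_eq] at hv hv'
    by_contra hne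
    rcases lt_or_gt_of_ne hne with h | h
    · exact key v v' hv.1.1 h hv'.1.2 hv.2 hv'.2 heq
    · exact key v' v hv'.1.1 h hv.1.2 hv'.2 hv.2 heq.symm
  simpa using this

lemma main_d {m n : ℕ} [NeZero m] (hm : 3 ≤ m) (hn : 2 ≤ n)
    (us : Fin n → ZMod m → ℝ) (hus : ∀ i v, 0 ≤ us i v) (c : ℝ) (hc0 : 0 ≤ c) (hc1 : c ≤ 1)
    (d x : ℕ) (hx : 1 ≤ x) (hxd : n ^ 2 ≤ x * d)
    (h1 : c * d ≤ n) (h2 : c * ((x : ℝ) + n - 2) ≤ n) :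
    ∃ P : Fin n → Finset (ZMod m), IsSplitOn (cycleGraph m) Finset.univ n P ∧
      ∀ i, c * mms (cycleGraph m) n (us i) ≤ bval (us i) (P i) := by
  classical
  have hmpos : 0 < m := by omega
  obtain ⟨N, hN⟩ : ∃ N, n = N + 2 := ⟨n - 2, by omega⟩
  have hNr : (n : ℝ) = N + 2 := by rw [hN]; push_cast; ring
  choose hμ0 Q hQ hQμ using fun i => mms_attained hm hn (us i) (hus i)
  set μ : Fin n → ℝ := fun i => mms (cycleGraph m) n (us i) with hμdef
  set τ : Fin n → ℝ := fun i => c * μ i with hτdef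
  have hτ0 : ∀ j, 0 ≤ τ j := fun j => mul_nonneg hc0 (hμ0 j)
  have hQτ : ∀ j i, τ j ≤ bval (us j) (Q j i) := by
    intro j i
    refine le_trans ?_ (hQμ j i)
    have := mul_le_mul_of_nonneg_right hc1 (hμ0 j)
    simpa [hτdef] using this
  change ∃ P : Fin n → Finset (ZMod m), IsSplitOn (cycleGraph m) Finset.univ n P ∧
      ∀ i, τ i ≤ bval (us i) (P i)
  by_cases hbig : ∃ A v, τ A ≤ us A v
  · obtain ⟨A, v, hAv⟩ := hbig
    obtain ⟨s, -, -, rfl⟩ := exists_lift 0 v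
    refine finish hm hN us hus τ hτ0 (s := s) (t := s+1) (by omega) (by omega) A ?_ ∅ (by simp) ?_
      (by simp) (by simp)
    · rw [ival_succ _ le_rfl, ival_self]; simpa using hAv
    · intro j _ _
      obtain ⟨i0, hi0⟩ := (hQ j).2.2.2 (s : ZMod m) (Finset.mem_univ _)
      refine strong_of_window (hQ j) (hQτ j) (by omega) (by omega) i0 ?_ hN
      intro k k1 k2
      have : k = s := by omega
      rw [this]; exact hi0
  push Not at hbig
  have hτpos : ∀ j, 0 < τ j := fun j => lt_of_le_of_lt (hus j 0) (hbig j 0)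
  have hQne : ∀ j i, (Q j i).Nonempty := by
    intro j i
    by_contra hcon
    rw [Finset.not_nonempty_iff_eq_empty] at hcon
    have := hQτ j i
    rw [hcon] at this
    simp [bval] at this
    linarith [hτpos j]
  let A0 : Fin n := ⟨0, by omega⟩
  obtain ⟨b, hb1, hbcut⟩ := exists_cut hn (hQ A0) (hQne A0)
  -- number of cuts in `(b, v]`
  let cuts : Fin n → ℕ → ℕ → Finset ℕ := fun j p q => (Finset.Ioc p q).filter (fun v => IsCut (Q j) v)
  let K : ℕ → ℕ := fun v => ∑ j, (cuts j b v).card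
  have hKlt : ∀ v, v < b + m → K v < n ^ 2 := by
    intro v hv
    have hle : ∀ j, (cuts j b v).card ≤ n := by
      intro j
      refine le_trans (Finset.card_le_card ?_) (card_cuts (hQ j) hb1)
      intro w hw
      simp only [cuts, Finset.mem_filter, Finset.mem_Ioc, Finset.mem_Ico] at hw ⊢
      exact ⟨⟨by omega, by omega⟩, hw.2⟩
    have hlt : (cuts A0 b v).card < n := by
      refine lt_of_lt_of_le (Finset.card_lt_card ?_) (card_cuts (hQ A0) hb1)
      rw [Finset.ssubset_iff_of_subset]
      · refine ⟨b, ?_, ?_⟩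
        · simp only [Finset.mem_filter, Finset.mem_Ico]
          exact ⟨⟨le_rfl, by omega⟩, hbcut⟩
        · simp [cuts]
      · intro w hw
        simp only [cuts, Finset.mem_filter, Finset.mem_Ioc, Finset.mem_Ico] at hw ⊢
        exact ⟨⟨by omega, by omega⟩, hw.2⟩
    have : K v < ∑ _j : Fin n, n :=
      Finset.sum_lt_sum (fun j _ => hle j) ⟨A0, Finset.mem_univ _, hlt⟩
    simpa [sq] using this
  have hKadd : ∀ p q, b ≤ p → p ≤ q → K q = K p + ∑ j, (cuts j p q).card := by
    intro p q hp hq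
    simp only [K]
    rw [← Finset.sum_add_distrib]
    refine Finset.sum_congr rfl (fun j _ => ?_)
    rw [← Finset.card_union_of_disjoint]
    · congr 1
      ext w
      simp only [cuts, Finset.mem_filter, Finset.mem_Ioc, Finset.mem_union]
      constructor
      · rintro ⟨h, h'⟩
        by_cases hwp : w ≤ p
        · exact Or.inl ⟨⟨h.1, hwp⟩, h'⟩
        · exact Or.inr ⟨⟨by omega, h.2⟩, h'⟩
      · rintro (⟨h, h'⟩ | ⟨h, h'⟩)
        · exact ⟨⟨h.1, by omega⟩, h'⟩
        · exact ⟨⟨by omega, h.2⟩, h'⟩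
    · rw [Finset.disjoint_left]
      intro w hw hw'
      simp only [cuts, Finset.mem_filter, Finset.mem_Ioc] at hw hw'
      omega
  -- a good block
  have hdpos : 0 < d := by
    rcases Nat.eq_zero_or_pos d with h | h
    · subst h; nlinarith
    · exact h
  have hblock : ∃ β ∈ Finset.range d, τ A0 ≤
      ∑ k ∈ (Finset.Ico b (b+m)).filter (fun k => K k / x = β), us A0 (k : ZMod m) := by
    apply Finset.exists_le_of_sum_le (Finset.nonempty_range_iff.mpr (by omega))
    rw [Finset.sum_fiberwise_of_maps_to (s := Finset.Ico b (b+m)) (t := Finset.range d)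
      (g := fun k => K k / x)]
    · have ht := total_ge (hQ A0) (hQμ A0) b
      unfold ival at ht
      refine le_trans ?_ ht
      simp only [Finset.sum_const, Finset.card_range, nsmul_eq_mul, hτdef]
      have := mul_le_mul_of_nonneg_right h1 (hμ0 A0)
      calc (d : ℝ) * (c * μ A0) = c * d * μ A0 := by ring
        _ ≤ _ := this
    · intro k hk
      rw [Finset.mem_range, Nat.div_lt_iff_lt_mul (by omega)]
      have := hKlt k (Finset.mem_Ico.mp hk).2
      calc K k < n ^ 2 := this
        _ ≤ x * d := hxd
        _ = d * x := by ring
  obtain ⟨β, -, hβ⟩ := hblock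
  set B := (Finset.Ico b (b+m)).filter (fun k => K k / x = β) with hB
  have hBne : B.Nonempty := by
    by_contra hcon
    rw [Finset.not_nonempty_iff_eq_empty] at hcon
    rw [hcon] at hβ
    simp at hβ
    linarith [hτpos A0]
  set s := B.min' hBne with hs
  set e := B.max' hBne with he
  have hsB : s ∈ B := Finset.min'_mem _ _
  have heB : e ∈ B := Finset.max'_mem _ _
  have hse : s ≤ e := Finset.min'_le _ _ heB
  simp only [hB, Finset.mem_filter, Finset.mem_Ico] at hsB heB
  have hcount : ∑ j, (cuts j s e).card + 1 ≤ x := by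
    have h3 := hKadd s e hsB.1.1 hse
    have h4 := Nat.div_add_mod (K s) x
    have h5 := Nat.div_add_mod (K e) x
    have h6 := Nat.mod_lt (K e) (show x > 0 by omega)
    rw [hsB.2] at h4
    rw [heB.2] at h5
    omega
  have hlike : τ A0 ≤ ival (fun k => us A0 (k : ZMod m)) s (e+1) := by
    refine hβ.trans ?_
    unfold ival
    apply Finset.sum_le_sum_of_subset_of_nonneg
    · intro k hk
      have := Finset.min'_le _ _ hk
      have := Finset.le_max' _ _ hk
      rw [Finset.mem_Ico]; omega
    · intros; exact hus _ _
  have hex : ∃ t, s ≤ t ∧ ∃ j, τ j ≤ ival (fun k => us j (k : ZMod m)) s t := ⟨e+1, by omega, A0, hlike⟩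
  obtain ⟨t, ⟨hst, j0, hj0⟩, htmin⟩ : ∃ t, (s ≤ t ∧ ∃ j, τ j ≤ ival (fun k => us j (k : ZMod m)) s t) ∧
      ∀ r, s ≤ r → (∃ j, τ j ≤ ival (fun k => us j (k : ZMod m)) s r) → t ≤ r :=
    ⟨Nat.find hex, Nat.find_spec hex, fun r h3 h4 => Nat.find_min' hex ⟨h3, h4⟩⟩
  have hte : t ≤ e + 1 := htmin (e+1) (by omega) ⟨A0, hlike⟩
  have hst' : s < t := by
    rcases Nat.eq_or_lt_of_le hst with h | h
    · rw [← h, ival_self] at hj0; linarith [hτpos j0]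
    · exact h
  have htm : t ≤ s + m := by
    have := hsB.1.1
    have := heB.1.2
    omega
  have hW2 : ∀ j, ival (fun k => us j (k : ZMod m)) s t ≤ 2 * τ j := by
    intro j
    obtain ⟨r, rfl⟩ : ∃ r, t = r + 1 := ⟨t - 1, by omega⟩
    rw [ival_succ _ (by omega)]
    have h3 : ival (fun k => us j (k : ZMod m)) s r < τ j := by
      by_contra hcon
      push Not at hcon
      have := htmin r (by omega) ⟨j, hcon⟩
      omega
    have := hbig j (r : ZMod m)
    linarith
  let Wk : Finset (Fin n) := Finset.univ.filter (fun j => ∃ v, s < v ∧ v < t ∧ IsCut (Q j) v)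
  have hWcard : Wk.card + 1 ≤ x := by
    refine le_trans ?_ hcount
    have : Wk.card ≤ ∑ j, (cuts j s e).card := by
      rw [Finset.card_eq_sum_ones]
      refine le_trans (Finset.sum_le_sum (g := fun j => (cuts j s e).card) ?_)
        (Finset.sum_le_sum_of_subset (Finset.subset_univ _))
      intro j hj
      simp only [Wk, Finset.mem_filter, Finset.mem_univ, true_and] at hj
      obtain ⟨v, v1, v2, v3⟩ := hj
      apply Finset.card_pos.mpr
      exact ⟨v, by simp only [cuts, Finset.mem_filter, Finset.mem_Ioc]; exact ⟨⟨v1, by omega⟩, v3⟩⟩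
    omega
  have hstrong : ∀ j, j ∉ Wk → Strong n (fun k => us j (k : ZMod m)) (τ j) (N+1) t (s+m) := by
    intro j hj
    obtain ⟨i0, hi0⟩ := no_cut_mono (hQ j) (s := s) (t := t) (by
      intro v v1 v2 v3
      exact hj (by simp only [Wk, Finset.mem_filter, Finset.mem_univ, true_and]; exact ⟨v, v1, v2, v3⟩))
    exact strong_of_window (hQ j) (hQτ j) hst' htm i0 hi0 hN
  have htot : ∀ j, c * ((x : ℝ) + n - 2) * μ j ≤
      ival (fun k => us j (k : ZMod m)) s t + ival (fun k => us j (k : ZMod m)) t (s+m) := by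
    intro j
    rw [ival_add hst htm]
    exact (mul_le_mul_of_nonneg_right h2 (hμ0 j)).trans (total_ge (hQ j) (hQμ j) s)
  have hWr : (Wk.card : ℝ) + 1 ≤ x := by exact_mod_cast hWcard
  by_cases hA : ∃ A ∈ Wk, τ A ≤ ival (fun k => us A (k : ZMod m)) s t
  · obtain ⟨A, hAW, hAl⟩ := hA
    refine finish hm hN us hus τ hτ0 hst htm A hAl (Wk.erase A) (by simp) ?_ ?_ ?_
    · intro j hjA hjW
      exact hstrong j (fun h => hjW (Finset.mem_erase.mpr ⟨hjA, h⟩))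
    · intro j hj
      have h3 := htot j
      have h4 := hW2 j
      have h5 : ((Wk.erase A).card : ℝ) + 1 = Wk.card := by
        exact_mod_cast Finset.card_erase_add_one hAW
      have h6 : τ j * ((N : ℝ) + (Wk.erase A).card) ≤ τ j * ((x : ℝ) + n - 4) :=
        mul_le_mul_of_nonneg_left (by rw [hNr]; linarith) (hτ0 j)
      have h7 : c * ((x : ℝ) + n - 2) * μ j = τ j * ((x : ℝ) + n - 4) + 2 * τ j := by
        simp only [hτdef]; ring
      linarith
    · intro j _ v; exact (hbig j v).le
  · push Not at hA
    have hj0W : j0 ∉ Wk := fun h => absurd (hA j0 h) (not_lt.mpr hj0)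
    refine finish hm hN us hus τ hτ0 hst htm j0 hj0 Wk hj0W ?_ ?_ ?_
    · intro j _ hjW; exact hstrong j hjW
    · intro j hj
      have h3 := htot j
      have h4 := hA j hj
      have h6 : τ j * ((N : ℝ) + Wk.card) ≤ τ j * ((x : ℝ) + n - 3) :=
        mul_le_mul_of_nonneg_left (by rw [hNr]; linarith) (hτ0 j)
      have h7 : c * ((x : ℝ) + n - 2) * μ j = τ j * ((x : ℝ) + n - 3) + τ j := by
        simp only [hτdef]; ring
      linarith
    · intro j _ v; exact (hbig j v).le

/-- a `c`-sufficient allocation on a cycle exists, where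
`c = max_{d ≥ n} min(n/d, n/(⌈n²/d⌉+n−2))`. -/
theorem stmt7 (m n : ℕ) [NeZero m] (hm : 3 ≤ m) (hn : 2 ≤ n)
    (us : Fin n → ZMod m → ℝ) (hus : ∀ i v, 0 ≤ us i v)
    (c : ℝ)
    (hc : c = sSup {x : ℝ | ∃ d : ℕ, n ≤ d ∧
      x = min ((n : ℝ) / (d : ℝ))
              ((n : ℝ) / (((⌈(n : ℝ) ^ 2 / (d : ℝ)⌉ : ℤ) : ℝ) + (n : ℝ) - 2))}) :
    ∃ P : Fin n → Finset (ZMod m), IsSplitOn (cycleGraph m) Finset.univ n P ∧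
      ∀ i, c * mms (cycleGraph m) n (us i) ≤ bval (us i) (P i) := by
  have hn' : (2:ℝ) ≤ n := by exact_mod_cast hn
  let f : ℕ → ℝ := fun d => min ((n : ℝ) / (d : ℝ))
              ((n : ℝ) / (((⌈(n : ℝ) ^ 2 / (d : ℝ)⌉ : ℤ) : ℝ) + (n : ℝ) - 2))
  have hfn : (1:ℝ)/2 ≤ f n := by
    have e1 : (n : ℝ) ^ 2 / n = ((n : ℤ) : ℝ) := by
      push_cast; field_simp
    have e2 : ⌈(n : ℝ) ^ 2 / (n : ℝ)⌉ = (n : ℤ) := by rw [e1, Int.ceil_intCast]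
    simp only [f]
    rw [e2]
    refine le_min ?_ ?_
    · rw [div_self (by positivity)]; norm_num
    · push_cast
      rw [div_le_div_iff₀ (by norm_num) (by linarith)]
      linarith
  obtain ⟨d, hd, hmax⟩ := Finset.exists_max_image (Finset.Icc n (2*n)) f ⟨n, by simp; omega⟩
  have hnd : n ≤ d := (Finset.mem_Icc.mp hd).1
  have hdr : (0:ℝ) < d := by
    have : 0 < d := by omega
    exact_mod_cast this
  have hfd : (1:ℝ)/2 ≤ f d := hfn.trans (hmax n (by simp; omega))
  have hg : IsGreatest {x : ℝ | ∃ d : ℕ, n ≤ d ∧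
      x = min ((n : ℝ) / (d : ℝ))
              ((n : ℝ) / (((⌈(n : ℝ) ^ 2 / (d : ℝ)⌉ : ℤ) : ℝ) + (n : ℝ) - 2))} (f d) := by
    refine ⟨⟨d, hnd, rfl⟩, ?_⟩
    rintro y ⟨d', hd', rfl⟩
    by_cases h : d' ≤ 2 * n
    · exact hmax d' (Finset.mem_Icc.mpr ⟨hd', h⟩)
    · refine le_trans (min_le_left _ _) (le_trans ?_ hfd)
      have h' : (2:ℝ) * n ≤ d' := by
        have : 2 * n ≤ d' := by omega
        exact_mod_cast this
      rw [div_le_div_iff₀ (by linarith) (by norm_num)]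
      linarith
  have hcf : c = f d := by rw [hc, hg.csSup_eq]
  have hpos : 0 < (n : ℝ) ^ 2 / (d : ℝ) := by positivity
  have hceil : 0 < ⌈(n : ℝ) ^ 2 / (d : ℝ)⌉ := Int.ceil_pos.mpr hpos
  obtain ⟨x, hx⟩ : ∃ x : ℕ, ⌈(n : ℝ) ^ 2 / (d : ℝ)⌉ = (x : ℤ) :=
    ⟨_, (Int.toNat_of_nonneg hceil.le).symm⟩
  have hx1 : 1 ≤ x := by rw [hx] at hceil; omega
  have hx1r : (1:ℝ) ≤ x := by exact_mod_cast hx1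
  have hxd : n ^ 2 ≤ x * d := by
    have h3 := Int.le_ceil ((n : ℝ) ^ 2 / (d : ℝ))
    rw [hx, div_le_iff₀ hdr] at h3
    exact_mod_cast h3
  have hc1 : c ≤ (n : ℝ) / d := by rw [hcf]; exact min_le_left _ _
  have hc2 : c ≤ (n : ℝ) / ((x : ℝ) + n - 2) := by
    rw [hcf]
    simp only [f]
    rw [hx]
    exact min_le_right _ _
  refine main_d hm hn us hus c (by rw [hcf]; linarith) ?_ d x hx1 hxd ?_ ?_
  · refine hc1.trans ?_
    rw [div_le_one hdr]
    exact_mod_cast hnd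
  · rwa [le_div_iff₀ hdr] at hc1
  · rwa [le_div_iff₀ (by linarith)] at hc2
end

section
/- For every n ≥ 1 agents with nonnegative additive utility functions on a cycle C of goods, there exists an allocation of goods into n connected bundles giving each agent i a bundle of value at least ψ·mms^(n)(C,u_i), where ψ = (√5 − 1)/2. -/
open scoped BigOperators

/-- A configuration: cuts `P 0 = p, P 1, ..., P N`, with agent `σ l` happy with the piece
`[P l, P (l+1))` for `l < N`; agent `σ (last)` is left over. -/
def CycValid (N : ℕ) (V : Fin (N + 1) → ℕ → ℝ) (c : ℝ) (p : ℕ) (P : ℕ → ℕ)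
    (σ : Equiv.Perm (Fin (N + 1))) : Prop :=
  P 0 = p ∧ ∀ l : Fin (N + 1), (l : ℕ) < N → c ≤ V (σ l) (P (l + 1)) - V (σ l) (P l)

lemma cyc_valid_lt {N : ℕ} {V : Fin (N + 1) → ℕ → ℝ} {c : ℝ} (hc0 : 0 < c)
    (hmono : ∀ i, Monotone (V i)) {p : ℕ} {P : ℕ → ℕ} {σ : Equiv.Perm (Fin (N + 1))}
    (h : CycValid N V c p P σ) (l : ℕ) (hl : l < N) : P l < P (l + 1) := by
  by_contra hcon
  have h1 := h.2 ⟨l, by omega⟩ hl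
  have h2 := hmono (σ ⟨l, by omega⟩) (not_lt.mp hcon)
  simp only at h1
  linarith

lemma cyc_exists_min (N m : ℕ) (V : Fin (N + 1) → ℕ → ℝ) (c : ℝ) (hc1 : c ≤ 1)
    (hper : ∀ i x, V i (x + m) = V i x + (N + 1)) (p : ℕ) :
    ∃ P σ, CycValid N V c p P σ ∧ ∀ P' σ', CycValid N V c p P' σ' →
      ∑ l ∈ Finset.range (N + 1), P l ≤ ∑ l ∈ Finset.range (N + 1), P' l := by
  classical
  have hex : ∃ s : ℕ, ∃ P σ, CycValid N V c p P σ ∧ ∑ l ∈ Finset.range (N + 1), P l = s := by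
    refine ⟨_, fun l => p + l * m, Equiv.refl _, ⟨by simp, ?_⟩, rfl⟩
    intro l _
    have h1 := hper l (p + l * m)
    have h2 : p + ((l : ℕ) + 1) * m = p + l * m + m := by ring
    simp only [Equiv.refl_apply]
    rw [h2, h1]
    have : (0 : ℝ) ≤ N := Nat.cast_nonneg _
    linarith
  obtain ⟨P, σ, hv, hs⟩ := Nat.find_spec hex
  refine ⟨P, σ, hv, fun P' σ' hv' => ?_⟩
  rw [hs]
  exact Nat.find_min' hex ⟨P', σ', hv', rfl⟩

lemma cyc_tok_ineq {N : ℕ} {V : Fin (N + 1) → ℕ → ℝ} {c : ℝ} (hc0 : 0 < c)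
    (hmono : ∀ i, Monotone (V i)) {p : ℕ} {P : ℕ → ℕ} {σ : Equiv.Perm (Fin (N + 1))}
    (h : CycValid N V c p P σ)
    (hmin : ∀ P' σ', CycValid N V c p P' σ' →
      ∑ l ∈ Finset.range (N + 1), P l ≤ ∑ l ∈ Finset.range (N + 1), P' l)
    (l : ℕ) (hl : l < N) :
    V (σ (Fin.last N)) (P (l + 1) - 1) - V (σ (Fin.last N)) (P l) < c := by
  classical
  by_contra hcon
  push Not at hcon
  have hlt := cyc_valid_lt hc0 hmono h l hl
  set l' : Fin (N + 1) := ⟨l, by omega⟩ with hl'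
  have hv : CycValid N V c p (Function.update P (l + 1) (P (l + 1) - 1))
      ((Equiv.swap l' (Fin.last N)).trans σ) := by
    refine ⟨by simp [Function.update, h.1], ?_⟩
    intro k hk
    have hkl : k ≠ Fin.last N := by
      intro hh; rw [hh] at hk; simp at hk
    by_cases hkl' : k = l'
    · subst hkl'
      simp only [Equiv.trans_apply, Equiv.swap_apply_left]
      have e1 : Function.update P (l + 1) (P (l + 1) - 1) ((l' : ℕ) + 1) = P (l + 1) - 1 := by
        simp [hl']
      have e2 : Function.update P (l + 1) (P (l + 1) - 1) (l' : ℕ) = P l := by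
        simp [hl', Function.update]
      rw [e1, e2]; exact hcon
    · have hkn : (k : ℕ) ≠ l := fun hh => hkl' (Fin.ext hh)
      simp only [Equiv.trans_apply, Equiv.swap_apply_of_ne_of_ne hkl' hkl]
      have e1 : Function.update P (l + 1) (P (l + 1) - 1) ((k : ℕ) + 1) = P (k + 1) := by
        rw [Function.update_of_ne]; omega
      have e2 : Function.update P (l + 1) (P (l + 1) - 1) (k : ℕ) ≤ P k := by
        by_cases hk2 : (k : ℕ) = l + 1
        · rw [hk2]; simp
        · rw [Function.update_of_ne hk2]
      have e3 := hmono (σ k) e2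
      have e4 := h.2 k hk
      rw [e1]; linarith
  have h1 := hmin _ _ hv
  have h2 : ∑ k ∈ Finset.range (N + 1), Function.update P (l + 1) (P (l + 1) - 1) k
      < ∑ k ∈ Finset.range (N + 1), P k := by
    apply Finset.sum_lt_sum
    · intro k _
      by_cases hk2 : k = l + 1
      · rw [hk2]; simp
      · rw [Function.update_of_ne hk2]
    · exact ⟨l + 1, by simp; omega, by simp; omega⟩
  omega

/-- Analysis of a leftover agent. -/
lemma cyc_token {N m : ℕ} {f : ℕ → ℝ} {c : ℝ} (hc0 : 0 < c) (hc : c ≤ 2 / 3)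
    (hmono : Monotone f) (hint : ∀ k : ℕ, ∃ b, f b = k) (P : ℕ → ℕ) (h0 : 0 ≤ f (P 0))
    (hper : f (P 0 + m) = f (P 0) + (N + 1))
    (htok : ∀ l < N, f (P (l + 1) - 1) - f (P l) < c)
    (hW : f (P 0 + m) - f (P N) < c) :
    ∃ B : ℕ, (∀ l ≤ N, f (P l) ≤ B + l + 1) ∧ (∀ l ≤ N, B + l + (1 - c) < f (P l)) ∧
      f (P 0) < B + c ∧ B + N + c ≤ f (P N) ∧
      (∀ l < N, f (P (l + 1)) - f (P l) < c → 
        1 ≤ l ∧ c ≤ f (P l) - f (P (l - 1))) := by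
  set B := ⌊f (P 0)⌋₊ with hB
  have hB1 : (B : ℝ) ≤ f (P 0) := Nat.floor_le h0
  have hB2 : f (P 0) < B + 1 := Nat.lt_floor_add_one _
  have step : ∀ l < N, ∀ k : ℕ, f (P l) + c ≤ k → f (P (l + 1)) ≤ k := by
    intro l hl k hk
    obtain ⟨b, hb⟩ := hint k
    have h1 := htok l hl
    have h2 : P (l + 1) ≤ b := by
      by_contra hcon
      have := hmono (show b ≤ P (l + 1) - 1 by omega)
      linarith
    have := hmono h2
    linarith
  have up : ∀ l ≤ N, f (P l) ≤ B + l + 1 := by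
    intro l
    induction l with
    | zero => intro _; simp; linarith
    | succ l ih =>
      intro hl
      have h1 := ih (by omega)
      have := step l (by omega) (B + (l + 1) + 1) (by push_cast; linarith)
      push_cast at this ⊢
      linarith
  have hN := up N le_rfl
  have hlow : ∀ l ≤ N, B + l + (1 - c) < f (P l) := by
    intro l hl
    by_contra hcon
    push Not at hcon
    have key : ∀ k, l < k → k ≤ N → f (P k) ≤ B + k := by
      intro k hlk
      induction k, hlk using Nat.le_induction with
      | base =>
        intro hk
        have := step l (by omega) (B + (l + 1)) (by push_cast; linarith)
        push_cast at this ⊢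
        linarith
      | succ k hk ih =>
        intro hkN
        have h1 := ih (by omega)
        have := step k (by omega) (B + (k + 1)) (by push_cast; linarith)
        push_cast at this ⊢
        linarith
    rcases Nat.lt_or_ge l N with h | h
    · have := key N h le_rfl
      linarith
    · have : l = N := by omega
      subst this
      linarith
  have hl0 := hlow 0 (by omega)
  have hlN : B + N + (2 - 2 * c) < f (P N) := by
    simp at hl0
    linarith
  refine ⟨B, up, hlow, by linarith, by linarith, ?_⟩
  intro l hl hdis
  have h1 := hlow (l + 1) hl
  push_cast at h1
  have h2 : B + l + (2 - 2 * c) < f (P l) := by linarith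
  have hl1 : 1 ≤ l := by
    rcases Nat.eq_zero_or_pos l with h | h
    · subst h
      simp at h2
      linarith
    · exact h
  refine ⟨hl1, ?_⟩
  have h3 := up (l - 1) (by omega)
  have h4 : ((l - 1 : ℕ) : ℝ) = l - 1 := by
    rw [Nat.cast_sub hl1]; simp
  rw [h4] at h3
  linarith

/-- One run from the cut `p`. -/
lemma cyc_run (N m : ℕ) (V : Fin (N + 1) → ℕ → ℝ) (c : ℝ) (hc0 : 0 < c) (hc : c ≤ 2 / 3)
    (hmono : ∀ i, Monotone (V i)) (hper : ∀ i x, V i (x + m) = V i x + (N + 1))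
    (hint : ∀ i, ∀ k : ℕ, ∃ b, V i b = k) (p : ℕ) (hp : ∀ i, 0 ≤ V i p) :
    (∃ P σ, CycValid N V c p P σ ∧
      c ≤ V (σ (Fin.last N)) (p + m) - V (σ (Fin.last N)) (P N)) ∨
    ∃ (S : Finset (Fin (N + 1))) (e : ℕ), p ≤ e ∧ N + 2 ≤ 2 * S.card ∧
      ∀ i ∈ S, (∃ B : ℕ, B + (1 - c) < V i p ∧ V i p < B + c) ∧
        (∃ B : ℕ, B + c ≤ V i e ∧ V i e ≤ B + 1) := by
  classical
  obtain ⟨P, σ, hv, hmin⟩ := cyc_exists_min N m V c (by linarith) hper p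
  by_cases hsucc : ∃ σ', CycValid N V c p P σ' ∧
      c ≤ V (σ' (Fin.last N)) (p + m) - V (σ' (Fin.last N)) (P N)
  · left
    obtain ⟨σ', h1, h2⟩ := hsucc
    exact ⟨P, σ', h1, h2⟩
  right
  push Not at hsucc
  have tok : ∀ σ', CycValid N V c p P σ' → ∃ B : ℕ,
      (∀ l ≤ N, V (σ' (Fin.last N)) (P l) ≤ B + l + 1) ∧
      (∀ l ≤ N, B + l + (1 - c) < V (σ' (Fin.last N)) (P l)) ∧
      V (σ' (Fin.last N)) (P 0) < B + c ∧ B + N + c ≤ V (σ' (Fin.last N)) (P N) ∧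
      (∀ l < N, V (σ' (Fin.last N)) (P (l + 1)) - V (σ' (Fin.last N)) (P l) < c → 
        1 ≤ l ∧ c ≤ V (σ' (Fin.last N)) (P l) - V (σ' (Fin.last N)) (P (l - 1))) := by
    intro σ' hv'
    have h3 := hsucc σ' hv'
    rw [← hv'.1] at h3
    exact cyc_token hc0 hc (hmono _) (hint _) P (by rw [hv'.1]; exact hp _) (hper _ _)
      (fun l hl => cyc_tok_ineq hc0 hmono hv' hmin l hl) h3
  set S : Finset (Fin (N + 1)) :=
    Finset.univ.filter (fun i => ∃ σ', CycValid N V c p P σ' ∧ σ' (Fin.last N) = i) with hS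
  refine ⟨S, P N, ?_, ?_, ?_⟩
  · have : ∀ l ≤ N, p ≤ P l := by
      intro l
      induction l with
      | zero => intro _; rw [hv.1]
      | succ l ih =>
        intro hl
        have h1 := ih (by omega)
        have h2 := cyc_valid_lt hc0 hmono hv l (by omega)
        omega
    exact this N le_rfl
  · set i := σ (Fin.last N) with hi
    obtain ⟨B, _, _, _, _, hdis⟩ := tok σ hv
    rw [← hi] at hdis
    set Lk := (Finset.range N).filter (fun l => c ≤ V i (P (l + 1)) - V i (P l)) with hLk
    set Dk := (Finset.range N).filter (fun l => ¬ c ≤ V i (P (l + 1)) - V i (P l)) with hDk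
    have hsum : Lk.card + Dk.card = N := by
      have := Finset.card_filter_add_card_filter_not (s := Finset.range N)
        (fun l => c ≤ V i (P (l + 1)) - V i (P l))
      rw [Finset.card_range] at this
      exact this
    have hDL : Dk.card ≤ Lk.card := by
      have hd : ∀ l ∈ Dk, l < N ∧ 1 ≤ l ∧ c ≤ V i (P l) - V i (P (l - 1)) := by
        intro l hl
        rw [hDk, Finset.mem_filter, Finset.mem_range, not_le] at hl
        exact ⟨hl.1, hdis l hl.1 hl.2⟩
      apply Finset.card_le_card_of_injOn (fun l => l - 1)
      · intro l hl
        obtain ⟨h1, h2, h3⟩ := hd l hl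
        rw [hLk]
        simp only [Finset.coe_filter, Finset.mem_range, Set.mem_setOf_eq]
        refine ⟨by omega, ?_⟩
        rw [Nat.sub_add_cancel h2]
        exact h3
      · intro l hl l' hl' hll
        have h1 := (hd l hl).2.1
        have h2 := (hd l' hl').2.1
        simp only at hll
        omega
    have hLS : Lk.card + 1 ≤ S.card := by
      have h1 : (Finset.cons (Fin.last N)
          (Finset.univ.filter (fun l : Fin (N + 1) => (l : ℕ) ∈ Lk)) (by
            simp [hLk])).card ≤ S.card := by
        apply Finset.card_le_card_of_injOn σ
        · intro l hl
          rw [hS]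
          simp only [Finset.coe_filter, Finset.mem_univ, true_and, Set.mem_setOf_eq]
          rw [Finset.mem_coe, Finset.mem_cons] at hl
          rcases hl with hl | hl
          · exact ⟨σ, hv, by rw [hl]⟩
          · rw [Finset.mem_filter, hLk, Finset.mem_filter, Finset.mem_range] at hl
            refine ⟨(Equiv.swap l (Fin.last N)).trans σ, ⟨hv.1, ?_⟩, by simp⟩
            intro k hk
            have hkl : k ≠ Fin.last N := by
              intro hh; rw [hh] at hk; simp at hk
            by_cases hkl' : k = l
            · subst hkl'
              simp only [Equiv.trans_apply, Equiv.swap_apply_left]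
              exact hl.2.2
            · simp only [Equiv.trans_apply, Equiv.swap_apply_of_ne_of_ne hkl' hkl]
              exact hv.2 k hk
        · exact σ.injective.injOn
      rw [Finset.card_cons] at h1
      have h2 : Lk.card ≤ (Finset.univ.filter (fun l : Fin (N + 1) => (l : ℕ) ∈ Lk)).card := by
        have h3 : Lk = (Finset.univ.filter (fun l : Fin (N + 1) => (l : ℕ) ∈ Lk)).image
            (fun l : Fin (N + 1) => (l : ℕ)) := by
          ext x
          simp only [Finset.mem_image, Finset.mem_filter, Finset.mem_univ, true_and]
          constructor
          · intro hx
            have : x < N := by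
              rw [hLk, Finset.mem_filter, Finset.mem_range] at hx
              exact hx.1
            exact ⟨⟨x, by omega⟩, hx, rfl⟩
          · rintro ⟨a, ha, rfl⟩
            exact ha
        calc Lk.card = _ := congrArg Finset.card h3
          _ ≤ _ := Finset.card_image_le
      omega
    omega
  · intro i hi
    rw [hS, Finset.mem_filter] at hi
    obtain ⟨_, σ', hv', rfl⟩ := hi
    obtain ⟨B, hup, hlow, h1, h2, _⟩ := tok σ' hv'
    have h3 := hlow 0 (by omega)
    rw [hv'.1] at h1 h3
    refine ⟨⟨B, by simpa using h3, h1⟩, ⟨B + N, by push_cast; linarith, ?_⟩⟩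
    have := hup N le_rfl
    push_cast
    linarith

/-- Two runs always suffice. -/
lemma cyc_main (N m : ℕ) (V : Fin (N + 1) → ℕ → ℝ) (c : ℝ) (hc0 : 0 < c) (hc : c ≤ 2 / 3)
    (hmono : ∀ i, Monotone (V i)) (hper : ∀ i x, V i (x + m) = V i x + (N + 1))
    (hint : ∀ i, ∀ k : ℕ, ∃ b, V i b = k) (p : ℕ) (hp : ∀ i, 0 ≤ V i p) :
    ∃ p P σ, CycValid N V c p P σ ∧
      c ≤ V (σ (Fin.last N)) (p + m) - V (σ (Fin.last N)) (P N) := by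
  classical
  rcases cyc_run N m V c hc0 hc hmono hper hint p hp with h | ⟨S, e, hpe, hS, hSi⟩
  · exact ⟨p, h⟩
  rcases cyc_run N m V c hc0 hc hmono hper hint e
    (fun i => (hp i).trans (hmono i hpe)) with h | ⟨S', e', _, hS', hSi'⟩
  · exact ⟨e, h⟩
  exfalso
  have hdisj : Disjoint S S' := by
    rw [Finset.disjoint_left]
    intro i hi hi'
    obtain ⟨_, B, h1, h2⟩ := hSi i hi
    obtain ⟨⟨B', h3, h4⟩, _⟩ := hSi' i hi'
    have h5 : (B : ℝ) < B' := by linarith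
    have h6 : (B' : ℝ) < B + 1 := by linarith
    have h7 : B < B' := by exact_mod_cast h5
    have h8 : B' < B + 1 := by exact_mod_cast h6
    omega
  have h1 := Finset.card_union_of_disjoint hdisj
  have h2 := Finset.card_le_univ (S ∪ S')
  rw [Fintype.card_fin] at h2
  omega

lemma cyc_adj {m : ℕ} (hm : 3 ≤ m) (v : ZMod m) : (cycleGraph m).Adj v (v + 1) := by
  rw [cycleGraph, SimpleGraph.fromRel_adj]
  refine ⟨?_, Or.inl rfl⟩
  intro h
  have h1 : (1 : ZMod m) = 0 := by
    have : v + 0 = v + 1 := by simpa using h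
    exact (add_left_cancel this).symm
  haveI : Fact (1 < m) := ⟨by omega⟩
  exact one_ne_zero h1

lemma cyc_adj_iff {m : ℕ} {v w : ZMod m} (h : (cycleGraph m).Adj v w) :
    w = v + 1 ∨ w = v - 1 := by
  rw [cycleGraph, SimpleGraph.fromRel_adj] at h
  rcases h.2 with h | h
  · exact Or.inl h
  · right; rw [h]; ring

/-- The arc `[a, b)`. -/
def cycArc (m : ℕ) (a b : ℕ) : Finset (ZMod m) :=
  (Finset.Ico a b).image (fun t : ℕ => (t : ZMod m))

lemma cyc_arc_bundle {m : ℕ} (hm : 3 ≤ m) (a b : ℕ) :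
    IsBundle (cycleGraph m) (cycArc m a b) := by
  rcases Nat.lt_or_ge a b with hab | hab
  · right
    have hmem : ∀ k, a + k < b → ((a + k : ℕ) : ZMod m) ∈ (cycArc m a b : Set (ZMod m)) := by
      intro k hk
      rw [cycArc, Finset.mem_coe, Finset.mem_image]
      exact ⟨a + k, by simp [hk], rfl⟩
    have hreach : ∀ k (hk : a + k < b),
        ((cycleGraph m).induce (cycArc m a b : Set (ZMod m))).Reachable
          ⟨((a + 0 : ℕ) : ZMod m), hmem 0 (by omega)⟩ ⟨((a + k : ℕ) : ZMod m), hmem k hk⟩ := by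
      intro k
      induction k with
      | zero => intro _; exact SimpleGraph.Reachable.refl _
      | succ k ih =>
        intro hk
        refine (ih (by omega)).trans (SimpleGraph.Adj.reachable ?_)
        rw [SimpleGraph.comap_adj]
        have := cyc_adj hm ((a + k : ℕ) : ZMod m)
        simp only [Function.Embedding.subtype_apply]
        convert this using 1
        push_cast; ring
    rw [SimpleGraph.connected_iff_exists_forall_reachable]
    refine ⟨⟨((a + 0 : ℕ) : ZMod m), hmem 0 (by omega)⟩, ?_⟩
    rintro ⟨w, hw⟩
    have hw' := hw
    rw [cycArc, Finset.mem_coe, Finset.mem_image] at hw'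
    obtain ⟨t, ht, rfl⟩ := hw'
    rw [Finset.mem_Ico] at ht
    have := hreach (t - a) (by omega)
    have e : a + (t - a) = t := by omega
    simp only [e] at this
    exact this
  · left
    simp [cycArc, Finset.Ico_eq_empty_of_le hab]

lemma cyc_cast_inj {m : ℕ} {p s t : ℕ} (hs : p ≤ s) (hs' : s < p + m) (ht : p ≤ t)
    (ht' : t < p + m) (h : (s : ZMod m) = (t : ZMod m)) : s = t := by
  rw [ZMod.natCast_eq_natCast_iff] at h
  rcases le_total s t with hst | hst
  · have h1 := (Nat.modEq_iff_dvd' hst).mp h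
    have := Nat.eq_zero_of_dvd_of_lt h1 (by omega)
    omega
  · have h1 := (Nat.modEq_iff_dvd' hst).mp h.symm
    have := Nat.eq_zero_of_dvd_of_lt h1 (by omega)
    omega

lemma cyc_cast_surj {m : ℕ} [NeZero m] (p : ℕ) (v : ZMod m) :
    ∃ t, p ≤ t ∧ t < p + m ∧ (t : ZMod m) = v := by
  have hm : 0 < m := Nat.pos_of_ne_zero (NeZero.ne m)
  refine ⟨p + (v - p : ZMod m).val, by omega, ?_, ?_⟩
  · have := ZMod.val_lt (v - p : ZMod m)
    omega
  · push_cast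
    rw [ZMod.natCast_zmod_val]
    ring

lemma cyc_bval_arc {m : ℕ} {p a b : ℕ} (u : ZMod m → ℝ) (hp : p ≤ a) (hb : b ≤ p + m) :
    bval u (cycArc m a b) = ∑ t ∈ Finset.Ico a b, u (t : ZMod m) := by
  rw [bval, cycArc, Finset.sum_image]
  intro s hs t ht h
  rw [Finset.mem_coe, Finset.mem_Ico] at hs ht
  exact cyc_cast_inj (p := p) (by omega) (by omega) (by omega) (by omega) h

/-- Turning a successful run into a split. -/
lemma cyc_build {m : ℕ} [NeZero m] (hm : 3 ≤ m) (N : ℕ) (p : ℕ) (P : ℕ → ℕ)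
    (σ : Equiv.Perm (Fin (N + 1))) (h0 : P 0 = p) (hN : P (N + 1) = p + m)
    (hmono : ∀ l ≤ N, P l ≤ P (l + 1)) :
    IsSplitOn (cycleGraph m) Finset.univ (N + 1)
      (fun i => cycArc m (P (σ.symm i)) (P (σ.symm i + 1))) := by
  have hle : ∀ b, b ≤ N + 1 → ∀ a, a ≤ b → P a ≤ P b := by
    intro b
    induction b with
    | zero => intro _ a ha; rw [Nat.le_zero.mp ha]
    | succ b ih =>
      intro hb a ha
      rcases Nat.lt_or_ge a (b + 1) with h | h
      · exact (ih (by omega) a (by omega)).trans (hmono b (by omega))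
      · rw [show a = b + 1 by omega]
  refine ⟨fun i => cyc_arc_bundle hm _ _, ?_, fun i => Finset.subset_univ _, ?_⟩
  · have key : ∀ k l : Fin (N + 1), k < l →
        Disjoint (cycArc m (P k) (P (k + 1))) (cycArc m (P l) (P (l + 1))) := by
      intro k l hkl
      rw [Finset.disjoint_left]
      intro v hv hv'
      rw [cycArc, Finset.mem_image] at hv hv'
      obtain ⟨s, hs, rfl⟩ := hv
      obtain ⟨t, ht, hst⟩ := hv'
      rw [Finset.mem_Ico] at hs ht
      have hk := k.2
      have hl := l.2
      have hkl' : (k : ℕ) < l := hkl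
      have h1 := hle k (by omega) 0 (by omega)
      have h2 := hle l (by omega) (k + 1) (by omega)
      have h3 := hle (N + 1) (by omega) (l + 1) (by omega)
      have := cyc_cast_inj (p := p) (by omega) (by omega) (by omega) (by omega) hst
      omega
    intro i j hij
    rcases lt_trichotomy (σ.symm i) (σ.symm j) with h | h | h
    · exact key _ _ h
    · exact absurd (σ.symm.injective h) hij
    · exact (key _ _ h).symm
  · intro v _
    obtain ⟨t, h1, h2, rfl⟩ := cyc_cast_surj p v
    have hex : ∃ k, t < P (k + 1) := ⟨N, by omega⟩
    classical
    have hf := Nat.find_spec hex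
    have hfN : Nat.find hex ≤ N := Nat.find_min' hex (by omega)
    have hf2 : P (Nat.find hex) ≤ t := by
      rcases Nat.eq_zero_or_pos (Nat.find hex) with h | h
      · rw [h]; omega
      · have := Nat.find_min hex (show Nat.find hex - 1 < Nat.find hex by omega)
        rw [Nat.sub_add_cancel h] at this
        omega
    refine ⟨σ ⟨Nat.find hex, by omega⟩, ?_⟩
    simp only [Equiv.symm_apply_apply]
    rw [cycArc, Finset.mem_image]
    exact ⟨t, by rw [Finset.mem_Ico]; exact ⟨hf2, hf⟩, rfl⟩

/-- The maximin share is attained. -/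
lemma cyc_mms_attained {m : ℕ} [NeZero m] (N : ℕ) (u : ZMod m → ℝ)
    (hpos : 0 < mms (cycleGraph m) (N + 1) u) :
    ∃ P : Fin (N + 1) → Finset (ZMod m), IsSplitOn (cycleGraph m) Finset.univ (N + 1) P ∧
      ∀ i, mms (cycleGraph m) (N + 1) u ≤ bval u (P i) := by
  classical
  set A : Set ℝ := {q : ℝ | ∃ P : Fin (N + 1) → Finset (ZMod m),
    IsSplitOn (cycleGraph m) Finset.univ (N + 1) P ∧ ∀ i, q ≤ bval u (P i)} with hA
  have hmms : mms (cycleGraph m) (N + 1) u = sSup A := rfl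
  have hne : A.Nonempty := by
    by_contra h
    rw [Set.not_nonempty_iff_eq_empty] at h
    rw [hmms, h, Real.sSup_empty] at hpos
    exact lt_irrefl _ hpos
  let g : (Fin (N + 1) → Finset (ZMod m)) → ℝ := fun P =>
    Finset.univ.inf' Finset.univ_nonempty (fun i => bval u (P i))
  let F : Finset (Fin (N + 1) → Finset (ZMod m)) :=
    Finset.univ.filter (fun P => IsSplitOn (cycleGraph m) Finset.univ (N + 1) P)
  have hF : F.Nonempty := by
    obtain ⟨q, P, hP, _⟩ := hne
    exact ⟨P, by simp [F, hP]⟩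
  obtain ⟨P, hPF, hmax⟩ := Finset.exists_max_image F g hF
  have hP : IsSplitOn (cycleGraph m) Finset.univ (N + 1) P := by
    simpa [F] using hPF
  refine ⟨P, hP, ?_⟩
  have h1 : sSup A ≤ g P := by
    apply csSup_le hne
    rintro q ⟨P', hP', hq⟩
    have h2 : q ≤ g P' := Finset.le_inf' _ _ (fun i _ => hq i)
    exact h2.trans (hmax P' (by simp [F, hP']))
  intro i
  rw [hmms]
  exact h1.trans (Finset.inf'_le _ (Finset.mem_univ i))

/-- A set closed under neighbours within a connected bundle fills it. -/
lemma cyc_fill {m : ℕ} {Q : Finset (ZMod m)} (hQ : IsBundle (cycleGraph m) Q)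
    (X : Set (ZMod m)) (v : ZMod m) (hv : v ∈ Q) (hvX : v ∈ X)
    (hcl : ∀ w ∈ X, ∀ w' ∈ Q, (cycleGraph m).Adj w w' → w' ∈ X) : ∀ w ∈ Q, w ∈ X := by
  intro w hw
  rcases hQ with hQ | hQ
  · exfalso
    have : v ∈ (Q : Set (ZMod m)) := hv
    rw [hQ] at this
    exact this
  · obtain ⟨walk⟩ := hQ.preconnected ⟨v, hv⟩ ⟨w, hw⟩
    have key : ∀ (a b : (Q : Set (ZMod m))),
        ((cycleGraph m).induce (Q : Set (ZMod m))).Walk a b → (a : ZMod m) ∈ X →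
          (b : ZMod m) ∈ X := by
      intro a b wk
      induction wk with
      | nil => exact id
      | cons h _ ih =>
        intro ha
        apply ih
        rw [SimpleGraph.comap_adj] at h
        exact hcl _ ha _ (Subtype.property _) h
    exact key _ _ walk hvX

/-- The normalised cumulative value function of an agent with positive share. -/
lemma cyc_cumul {m : ℕ} [NeZero m] (hm : 3 ≤ m) (N : ℕ) (u : ZMod m → ℝ) (hu : ∀ v, 0 ≤ u v)
    (μ : ℝ) (hμ : 0 < μ) (Q : Fin (N + 1) → Finset (ZMod m))
    (hQ : IsSplitOn (cycleGraph m) Finset.univ (N + 1) Q) (hval : ∀ i, μ ≤ bval u (Q i)) :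
    ∃ V : ℕ → ℝ, Monotone V ∧ (∀ x, V (x + m) = V x + (N + 1)) ∧
      (∀ k : ℕ, ∃ b, V b = k) ∧ 0 ≤ V m ∧
      ∀ a b, a ≤ b → μ * (V b - V a) ≤ ∑ t ∈ Finset.Ico a b, u (t : ZMod m) := by
  classical
  obtain ⟨hbun, hdis, _, hcov⟩ := hQ
  choose idx hidx using fun v => hcov v (Finset.mem_univ v)
  have hidx' : ∀ v i, v ∈ Q i → idx v = i := by
    intro v i hv
    by_contra hne
    exact Finset.disjoint_left.mp (hdis _ _ hne) (hidx v) hv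
  have hb0 : ∀ i, 0 < bval u (Q i) := fun i => hμ.trans_le (hval i)
  let w : ZMod m → ℝ := fun v => u v / bval u (Q (idx v))
  have hw0 : ∀ v, 0 ≤ w v := fun v => div_nonneg (hu v) (hb0 _).le
  have hwu : ∀ v, μ * w v ≤ u v := by
    intro v
    have h1 := hval (idx v)
    have h2 := hb0 (idx v)
    have : w v * bval u (Q (idx v)) = u v := div_mul_cancel₀ _ h2.ne'
    nlinarith [hw0 v]
  have hwQ : ∀ i, ∑ v ∈ Q i, w v = 1 := by
    intro i
    have : ∑ v ∈ Q i, w v = ∑ v ∈ Q i, u v / bval u (Q i) := by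
      apply Finset.sum_congr rfl
      intro v hv
      simp only [w]
      rw [hidx' v i hv]
    rw [this, ← Finset.sum_div]
    exact div_self (hb0 i).ne'
  have hwtot : ∑ v, w v = N + 1 := by
    have h1 : (Finset.univ : Finset (ZMod m)) = Finset.univ.biUnion Q := by
      ext v; simp only [Finset.mem_univ, Finset.mem_biUnion, true_and, true_iff]
      exact ⟨idx v, hidx v⟩
    rw [h1, Finset.sum_biUnion (fun i _ j _ hij => hdis i j hij)]
    simp [hwQ]
  let W : ℕ → ℝ := fun x => ∑ t ∈ Finset.range x, w (t : ZMod m)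
  have hWdiff : ∀ a b, a ≤ b → W b - W a = ∑ t ∈ Finset.Ico a b, w (t : ZMod m) := by
    intro a b hab
    rw [Finset.sum_Ico_eq_sub _ hab]
  have hWmono : Monotone W := by
    intro a b hab
    have := hWdiff a b hab
    have h2 : 0 ≤ ∑ t ∈ Finset.Ico a b, w (t : ZMod m) := Finset.sum_nonneg (fun t _ => hw0 _)
    linarith
  have hWper : ∀ x, W (x + m) = W x + (N + 1) := by
    intro x
    have h1 := hWdiff x (x + m) (by omega)
    have h2 := cyc_bval_arc (p := x) w (le_refl x) (le_refl (x + m))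
    have h3 : cycArc m x (x + m) = Finset.univ := by
      ext v
      simp only [Finset.mem_univ, iff_true]
      obtain ⟨t, ht1, ht2, rfl⟩ := cyc_cast_surj x v
      rw [cycArc, Finset.mem_image]
      exact ⟨t, by rw [Finset.mem_Ico]; exact ⟨ht1, ht2⟩, rfl⟩
    rw [h3, bval, hwtot] at h2
    linarith
  -- boundaries
  let Bd : ℕ → Prop := fun b => N = 0 ∨ idx ((b : ZMod m) - 1) ≠ idx (b : ZMod m)
  have hnext : ∀ b, Bd b → ∃ b', Bd b' ∧ W b' = W b + 1 := by
    intro b hb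
    by_cases hN : N = 0
    · refine ⟨b + m, Or.inl hN, ?_⟩
      rw [hWper, hN]; simp
    have hb' : idx ((b : ZMod m) - 1) ≠ idx (b : ZMod m) := by
      rcases hb with h | h
      · exact absurd h hN
      · exact h
    set i := idx (b : ZMod m) with hi
    have hex : ∃ k, idx (((b + k : ℕ) : ZMod m)) ≠ i := by
      refine ⟨m - 1, ?_⟩
      have : ((b + (m - 1) : ℕ) : ZMod m) = (b : ZMod m) - 1 := by
        rw [Nat.cast_add, Nat.cast_sub (by omega), ZMod.natCast_self]
        push_cast; ring
      rw [this]; exact hb'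
    have hf := Nat.find_spec hex
    have hfle : Nat.find hex ≤ m - 1 := by
      apply Nat.find_min' hex
      have : ((b + (m - 1) : ℕ) : ZMod m) = (b : ZMod m) - 1 := by
        rw [Nat.cast_add, Nat.cast_sub (by omega), ZMod.natCast_self]
        push_cast; ring
      rw [this]; exact hb'
    have hflt : ∀ k < Nat.find hex, idx (((b + k : ℕ) : ZMod m)) = i := by
      intro k hk
      have := Nat.find_min hex hk
      push Not at this
      exact this
    set K := Nat.find hex with hK
    have hK1 : 1 ≤ K := by
      rcases Nat.eq_zero_or_pos K with h | h
      · exfalso; apply hf; rw [h]; simp [hi]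
      · exact h
    have harc : cycArc m b (b + K) = Q i := by
      apply Finset.Subset.antisymm
      · intro v hv
        rw [cycArc, Finset.mem_image] at hv
        obtain ⟨t, ht, rfl⟩ := hv
        rw [Finset.mem_Ico] at ht
        have h1 := hflt (t - b) (by omega)
        rw [show b + (t - b) = t by omega] at h1
        rw [← h1]; exact hidx _
      · intro v hv
        have hbi : (b : ZMod m) ∈ Q i := by rw [hi]; exact hidx _
        refine cyc_fill (hbun i) (cycArc m b (b + K) : Set (ZMod m)) (b : ZMod m) hbi ?_ ?_ v hv
        · rw [Finset.mem_coe, cycArc, Finset.mem_image]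
          exact ⟨b, by rw [Finset.mem_Ico]; omega, rfl⟩
        · intro x hx y hy hxy
          rw [Finset.mem_coe, cycArc, Finset.mem_image] at hx ⊢
          obtain ⟨t, ht, rfl⟩ := hx
          rw [Finset.mem_Ico] at ht
          have hyi := hidx' y i hy
          rcases cyc_adj_iff hxy with h | h
          · refine ⟨t + 1, ?_, by rw [h]; push_cast; ring⟩
            rw [Finset.mem_Ico]
            refine ⟨by omega, ?_⟩
            by_contra hcon
            apply hf
            rw [show b + K = t + 1 by omega, ← hyi, h]
            push_cast; ring_nf
          · rcases Nat.lt_or_ge b t with h2 | h2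
            · refine ⟨t - 1, by rw [Finset.mem_Ico]; omega, ?_⟩
              rw [h, Nat.cast_sub (by omega)]; simp
            · exfalso
              apply hb'
              rw [← hyi, h, show t = b by omega]
    refine ⟨b + K, Or.inr ?_, ?_⟩
    · have h1 := hflt (K - 1) (by omega)
      have h2 : ((b + (K - 1) : ℕ) : ZMod m) = ((b + K : ℕ) : ZMod m) - 1 := by
        rw [show b + K = b + (K - 1) + 1 by omega]
        push_cast; ring
      rw [h2] at h1
      rw [h1]; exact fun h => hf h.symm
    · have h1 := hWdiff b (b + K) (by omega)
      have h2 := cyc_bval_arc (p := b) w (le_refl b) (show b + K ≤ b + m by omega)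
      rw [harc, bval, hwQ i] at h2
      linarith
  have hstart : ∃ b, b ≤ m ∧ Bd b := by
    by_cases hN : N = 0
    · exact ⟨0, by omega, Or.inl hN⟩
    by_contra hcon
    push Not at hcon
    have hall : ∀ b, b ≤ m → idx (b : ZMod m) = idx ((0 : ℕ) : ZMod m) := by
      intro b
      induction b with
      | zero => intro _; rfl
      | succ b ih =>
        intro hb
        have h1 := hcon (b + 1) hb
        simp only [Bd, not_or, not_not] at h1
        rw [← h1.2, ← ih (by omega)]
        congr 1
        push_cast; ring
    have hQne : ∀ i, ∃ v, v ∈ Q i := by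
      intro i
      by_contra h
      push Not at h
      have : Q i = ∅ := Finset.eq_empty_of_forall_notMem h
      have h2 := hb0 i
      rw [this, bval, Finset.sum_empty] at h2
      exact lt_irrefl _ h2
    have hconst : ∀ i, i = idx ((0 : ℕ) : ZMod m) := by
      intro i
      obtain ⟨v, hv⟩ := hQne i
      obtain ⟨t, _, ht, rfl⟩ := cyc_cast_surj 0 v
      rw [← hidx' _ _ hv]
      exact hall t (by omega)
    have h01 : (0 : Fin (N + 1)) = Fin.last N := (hconst _).trans (hconst _).symm
    have := congrArg Fin.val h01
    simp at this
    omega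
  obtain ⟨b0, hb0m, hb0B⟩ := hstart
  refine ⟨fun x => W x - W b0, ?_, ?_, ?_, ?_, ?_⟩
  · intro a b hab
    have := hWmono hab
    simp only
    linarith
  · intro x
    simp only
    rw [hWper]; ring
  · have : ∀ k : ℕ, ∃ b, Bd b ∧ W b - W b0 = k := by
      intro k
      induction k with
      | zero => exact ⟨b0, hb0B, by simp⟩
      | succ k ih =>
        obtain ⟨b, hb, hk⟩ := ih
        obtain ⟨b', hb', hk'⟩ := hnext b hb
        refine ⟨b', hb', ?_⟩
        push_cast
        linarith
    intro k
    obtain ⟨b, _, hb⟩ := this k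
    exact ⟨b, hb⟩
  · have := hWmono hb0m
    simp only
    linarith
  · intro a b hab
    have h1 := hWdiff a b hab
    have h2 : W b - W b0 - (W a - W b0) = W b - W a := by ring
    simp only
    rw [h2, h1, Finset.mul_sum]
    exact Finset.sum_le_sum (fun t _ => hwu _)

/-- for any number of agents there is a `ψ`-sufficient allocation on a
cycle, where `ψ = (√5 − 1)/2`. -/
theorem stmt8 (m n : ℕ) [NeZero m] (hm : 3 ≤ m) (hn : 1 ≤ n)
    (us : Fin n → ZMod m → ℝ) (hus : ∀ i v, 0 ≤ us i v) :
    ∃ P : Fin n → Finset (ZMod m), IsSplitOn (cycleGraph m) Finset.univ n P ∧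
      ∀ i, (Real.sqrt 5 - 1) / 2 * mms (cycleGraph m) n (us i) ≤ bval (us i) (P i) := by
  classical
  obtain ⟨N, rfl⟩ : ∃ N, n = N + 1 := ⟨n - 1, by omega⟩
  have hs1 : Real.sqrt 5 * Real.sqrt 5 = 5 := Real.mul_self_sqrt (by norm_num)
  have hs0 : 0 ≤ Real.sqrt 5 := Real.sqrt_nonneg 5
  set c : ℝ := (Real.sqrt 5 - 1) / 2 with hc
  have hc0 : 0 < c := by
    have : 1 < Real.sqrt 5 := by nlinarith
    rw [hc]; linarith
  have hc23 : c ≤ 2 / 3 := by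
    have : Real.sqrt 5 ≤ 7 / 3 := by nlinarith
    rw [hc]; linarith
  have hbv : ∀ i S, 0 ≤ bval (us i) S := fun i S => Finset.sum_nonneg (fun v _ => hus i v)
  have hcum : ∀ i, 0 < mms (cycleGraph m) (N + 1) (us i) →
      ∃ V : ℕ → ℝ, Monotone V ∧ (∀ x, V (x + m) = V x + (N + 1)) ∧
      (∀ k : ℕ, ∃ b, V b = k) ∧ 0 ≤ V m ∧
      ∀ a b, a ≤ b → mms (cycleGraph m) (N + 1) (us i) * (V b - V a) ≤
        ∑ t ∈ Finset.Ico a b, us i (t : ZMod m) := by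
    intro i hi
    obtain ⟨Q, hQ, hval⟩ := cyc_mms_attained N (us i) hi
    exact cyc_cumul hm N (us i) (hus i) _ hi Q hQ hval
  by_cases hall : ∃ i, 0 < mms (cycleGraph m) (N + 1) (us i)
  · obtain ⟨i0, hi0⟩ := hall
    have hV : ∀ i, ∃ V : ℕ → ℝ, Monotone V ∧ (∀ x, V (x + m) = V x + (N + 1)) ∧
        (∀ k : ℕ, ∃ b, V b = k) ∧ 0 ≤ V m ∧
        (0 < mms (cycleGraph m) (N + 1) (us i) → ∀ a b, a ≤ b →
          mms (cycleGraph m) (N + 1) (us i) * (V b - V a) ≤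
          ∑ t ∈ Finset.Ico a b, us i (t : ZMod m)) := by
      intro i
      by_cases hi : 0 < mms (cycleGraph m) (N + 1) (us i)
      · obtain ⟨V, h1, h2, h3, h4, h5⟩ := hcum i hi
        exact ⟨V, h1, h2, h3, h4, fun _ => h5⟩
      · obtain ⟨V, h1, h2, h3, h4, _⟩ := hcum i0 hi0
        exact ⟨V, h1, h2, h3, h4, fun h => absurd h hi⟩
    choose V hmono hper hint hVm hVu using hV
    obtain ⟨p, P, σ, hv, hlast⟩ := cyc_main N m V c hc0 hc23 hmono hper hint m hVm
    -- extend the cuts by the final one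
    let P' : ℕ → ℕ := fun l => if l ≤ N then P l else p + m
    have hP'N : P' (N + 1) = p + m := by simp [P']
    have hP'le : ∀ l ≤ N, P' l = P l := fun l hl => by simp [P', hl]
    have hlike : ∀ l : Fin (N + 1), c ≤ V (σ l) (P' (l + 1)) - V (σ l) (P' l) := by
      intro l
      rcases Nat.lt_or_ge l N with h | h
      · rw [hP'le _ (by omega), hP'le _ (by omega)]
        exact hv.2 l h
      · have hl : l = Fin.last N := Fin.ext (by have := l.2; simp; omega)
        subst hl
        simp only [Fin.val_last]
        rw [hP'N, hP'le _ le_rfl]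
        exact hlast
    have hP'mono : ∀ l ≤ N, P' l ≤ P' (l + 1) := by
      intro l hl
      by_contra hcon
      have h1 := hlike ⟨l, by omega⟩
      have h2 := hmono (σ ⟨l, by omega⟩) (not_le.mp hcon).le
      simp only at h1
      linarith
    have hP'0 : P' 0 = p := by rw [hP'le 0 (by omega)]; exact hv.1
    have hchain : ∀ b, b ≤ N + 1 → ∀ a, a ≤ b → P' a ≤ P' b := by
      intro b
      induction b with
      | zero => intro _ a ha; rw [Nat.le_zero.mp ha]
      | succ b ih =>
        intro hb a ha
        rcases Nat.lt_or_ge a (b + 1) with h | h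
        · exact (ih (by omega) a (by omega)).trans (hP'mono b (by omega))
        · rw [show a = b + 1 by omega]
    refine ⟨_, cyc_build hm N p P' σ hP'0 hP'N hP'mono, ?_⟩
    intro i
    by_cases hi : 0 < mms (cycleGraph m) (N + 1) (us i)
    · obtain ⟨l, rfl⟩ := σ.surjective i
      simp only [Equiv.symm_apply_apply]
      have hl := l.2
      rw [cyc_bval_arc (p := p) (us (σ l))
        (by rw [← hP'0]; exact hchain l (by omega) 0 (by omega))
        (by rw [← hP'N]; exact hchain (N + 1) le_rfl (l + 1) (by omega))]
      have h1 := hVu (σ l) hi (P' l) (P' (l + 1)) (hP'mono l (by omega))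
      have h2 := mul_le_mul_of_nonneg_left (hlike l) hi.le
      linarith
    · have h1 := hbv i (cycArc m (P' (σ.symm i)) (P' (σ.symm i + 1)))
      have h2 : c * mms (cycleGraph m) (N + 1) (us i) ≤ 0 :=
        mul_nonpos_of_nonneg_of_nonpos hc0.le (not_lt.mp hi)
      exact h2.trans h1
  · push Not at hall
    refine ⟨_, cyc_build hm N 0 (fun l => if l = 0 then 0 else m) (Equiv.refl _) (by simp)
      (by simp) (by intro l _; by_cases h : l = 0 <;> simp [h]), ?_⟩
    intro i
    have h2 : c * mms (cycleGraph m) (N + 1) (us i) ≤ 0 :=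
      mul_nonpos_of_nonneg_of_nonpos hc0.le (hall i)
    exact h2.trans (hbv i _)
end
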